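/- arXiv:2505.01600 — 4 statements merged into one kernel-verified Lean document; each statement's English description precedes it below -/
import Mathlib

section
/- Suppose (γ, β, Y₀, Y₁, Y₂) takes values in a compact set C ⊂ ℝ⁵, its joint distribution is absolutely continuous with respect to Lebesgue measure on ℝ⁵ with a density that is strictly positive on C, and it satisfies the two conditional moment restrictions of the heterogeneous-coefficient AR(1) model. Then E(β) is not point-identified: there exist real random variables (γ̃, β̃, Ỹ₀, Ỹ₁, Ỹ₂) on some probability space satisfying the same two conditional moment restrictions (with (γ̃, β̃, Ỹ₀, Ỹ₁, Ỹ₂) in place of (γ, β, Y₀, Y₁, Y₂)), such that (Ỹ₀, Ỹ₁, Ỹ₂) has the same joint distribution as (Y₀, Y₁, Y₂) but E(β̃) > E(β). -/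
open MeasureTheory
open scoped ENNReal

/-- `f` is `m`-measurable and `ν`-almost everywhere bounded. -/
structure AEBdd {α : Type*} (m : MeasurableSpace α) {m0 : MeasurableSpace α} (ν : Measure α)
    (f : α → ℝ) : Prop where
  measurable : Measurable[m] f
  exists_bound : ∃ K : ℝ, ∀ᵐ x ∂ν, |f x| ≤ K

/-- `F` is `ν`-almost everywhere bounded and its conditional expectation given `m` vanishes,
expressed by testing against bounded `m`-measurable functions. -/
structure CondZero {α : Type*} (m : MeasurableSpace α) {m0 : MeasurableSpace α} (ν : Measure α)
    (F : α → ℝ) : Prop where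
  aebdd : AEBdd m0 ν F
  integral_mul : ∀ ψ : α → ℝ, Measurable[m] ψ → (∃ K : ℝ, ∀ x, |ψ x| ≤ K) →
    ∫ x, ψ x * F x ∂ν = 0

namespace AEBdd

variable {α : Type*} {m m' m0 : MeasurableSpace α} {ν : Measure α} {f g : α → ℝ}

lemma const (c : ℝ) : AEBdd m ν (fun _ => c) :=
  ⟨measurable_const, |c|, by simp⟩

lemma add (hf : AEBdd m ν f) (hg : AEBdd m ν g) : AEBdd m ν (fun x => f x + g x) := by
  obtain ⟨hf, K, hK⟩ := hf
  obtain ⟨hg, L, hL⟩ := hg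
  refine ⟨hf.add hg, K + L, ?_⟩
  filter_upwards [hK, hL] with x h1 h2
  exact (abs_add_le _ _).trans (add_le_add h1 h2)

lemma mul (hf : AEBdd m ν f) (hg : AEBdd m ν g) : AEBdd m ν (fun x => f x * g x) := by
  obtain ⟨hf, K, hK⟩ := hf
  obtain ⟨hg, L, hL⟩ := hg
  refine ⟨hf.mul hg, K * L, ?_⟩
  filter_upwards [hK, hL] with x h1 h2
  rw [abs_mul]
  exact mul_le_mul h1 h2 (abs_nonneg _) ((abs_nonneg _).trans h1)

lemma neg (hf : AEBdd m ν f) : AEBdd m ν (fun x => -f x) := by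
  simpa using (const (-1)).mul hf

lemma sub (hf : AEBdd m ν f) (hg : AEBdd m ν g) : AEBdd m ν (fun x => f x - g x) := by
  simpa [sub_eq_add_neg] using hf.add hg.neg

lemma pow (hf : AEBdd m ν f) (n : ℕ) : AEBdd m ν (fun x => f x ^ n) := by
  induction n with
  | zero => simpa using const 1
  | succ n ih => simpa [pow_succ] using ih.mul hf

lemma max_zero (hf : AEBdd m ν f) : AEBdd m ν (fun x => max (f x) 0) := by
  obtain ⟨hf, K, hK⟩ := hf
  refine ⟨hf.max measurable_const, K, ?_⟩
  filter_upwards [hK] with x h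
  refine le_trans ?_ h
  rcases le_total (f x) 0 with h0 | h0 <;> simp [h0]

lemma indicator {s : Set α} (hs : MeasurableSet[m] s) :
    AEBdd m ν (s.indicator fun _ => (1 : ℝ)) := by
  refine ⟨measurable_const.indicator hs, 1, ae_of_all _ fun x => ?_⟩
  by_cases h : x ∈ s <;> simp [h]

lemma mono (hm : m ≤ m') (hf : AEBdd m ν f) : AEBdd m' ν f :=
  ⟨hf.measurable.mono hm le_rfl, hf.exists_bound⟩

lemma ac {ν' : Measure α} (hν : ν' ≪ ν) (hf : AEBdd m ν f) : AEBdd m ν' f :=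
  ⟨hf.measurable, hf.exists_bound.imp fun _ h => hν.ae_le h⟩

lemma integrable [IsFiniteMeasure ν] (hf : AEBdd m0 ν f) : Integrable f ν := by
  obtain ⟨hf, K, hK⟩ := hf
  exact Integrable.of_bound hf.aestronglyMeasurable K (by simpa using hK)

lemma exists_bounded (hf : AEBdd m ν f) :
    ∃ g : α → ℝ, Measurable[m] g ∧ (∃ K : ℝ, ∀ x, |g x| ≤ K) ∧ g =ᵐ[ν] f := by
  obtain ⟨hf, K, hK⟩ := hf
  refine ⟨fun x => max (-|K|) (min |K| (f x)), measurable_const.max (measurable_const.min hf),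
    ⟨|K|, fun x => ?_⟩, ?_⟩
  · rw [abs_le]
    exact ⟨le_max_left _ _, max_le (by linarith [abs_nonneg K]) (min_le_left _ _)⟩
  · filter_upwards [hK] with x h
    have := abs_le.1 (h.trans (le_abs_self K))
    simp [this.1, this.2]

/-- A common bound that is at least one. -/
lemma exists_one_le_bound (hf : AEBdd m ν f) : ∃ K : ℝ, 1 ≤ K ∧ ∀ᵐ x ∂ν, |f x| ≤ K := by
  obtain ⟨K, hK⟩ := hf.exists_bound
  exact ⟨max 1 K, le_max_left _ _, hK.mono fun x h => h.trans (le_max_right _ _)⟩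

end AEBdd

namespace CondZero

variable {α : Type*} {m m' m0 : MeasurableSpace α} {ν : Measure α} {F G : α → ℝ}

lemma integral_aebdd_mul (hF : CondZero m ν F) {ψ : α → ℝ} (hψ : AEBdd m ν ψ) :
    ∫ x, ψ x * F x ∂ν = 0 := by
  obtain ⟨g, hg, hgK, hgψ⟩ := hψ.exists_bounded
  rw [← hF.integral_mul g hg hgK]
  refine integral_congr_ae ?_
  filter_upwards [hgψ] with x hx
  rw [hx]

lemma integral_eq_zero (hF : CondZero m ν F) : ∫ x, F x ∂ν = 0 := by
  simpa using hF.integral_aebdd_mul (AEBdd.const 1)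

lemma add [IsFiniteMeasure ν] (hm : m ≤ m0) (hF : CondZero m ν F) (hG : CondZero m ν G) :
    CondZero m ν (fun x => F x + G x) := by
  refine ⟨hF.aebdd.add hG.aebdd, fun ψ hψ hK => ?_⟩
  have h : AEBdd m0 ν ψ := ⟨hψ.mono hm le_rfl, hK.imp fun _ h => ae_of_all _ h⟩
  simp only [mul_add]
  rw [integral_add (h.mul hF.aebdd).integrable (h.mul hG.aebdd).integrable,
    hF.integral_mul ψ hψ hK, hG.integral_mul ψ hψ hK, add_zero]

lemma mul (hm : m ≤ m0) {c : α → ℝ} (hc : AEBdd m ν c) (hF : CondZero m ν F) :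
    CondZero m ν (fun x => c x * F x) := by
  refine ⟨(hc.mono hm).mul hF.aebdd, fun ψ hψ hK => ?_⟩
  have h : AEBdd m ν ψ := ⟨hψ, hK.imp fun _ h => ae_of_all _ h⟩
  simpa [mul_assoc] using hF.integral_aebdd_mul (h.mul hc)

lemma mono (hm : m ≤ m') (hF : CondZero m' ν F) : CondZero m ν F :=
  ⟨hF.aebdd, fun ψ hψ => hF.integral_mul ψ (hψ.mono hm le_rfl)⟩

lemma congr (h : ∀ x, F x = G x) (hF : CondZero m ν F) : CondZero m ν G := by
  rwa [← funext h]

lemma add_measure {ν' : Measure α} [IsFiniteMeasure ν] [IsFiniteMeasure ν'] (hm : m ≤ m0)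
    (h : CondZero m ν F) (h' : CondZero m ν' F) : CondZero m (ν + ν') F := by
  obtain ⟨hF, K, hK⟩ := h.aebdd
  obtain ⟨-, L, hL⟩ := h'.aebdd
  refine ⟨⟨hF, max K L, ?_⟩, fun ψ hψ hb => ?_⟩
  · rw [ae_add_measure_iff]
    exact ⟨hK.mono fun x hx => hx.trans (le_max_left _ _),
      hL.mono fun x hx => hx.trans (le_max_right _ _)⟩
  · have hψ' : ∀ κ : Measure α, AEBdd m0 κ ψ :=
      fun κ => ⟨hψ.mono hm le_rfl, hb.imp fun _ h => ae_of_all _ h⟩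
    rw [integral_add_measure ((hψ' ν).mul h.aebdd).integrable ((hψ' ν').mul h'.aebdd).integrable,
      h.integral_mul ψ hψ hb, h'.integral_mul ψ hψ hb, add_zero]

lemma condExp_eq_zero [IsFiniteMeasure ν] (hm : m ≤ m0) (h : CondZero m ν F) :
    ν[F|m] =ᵐ[ν] 0 := by
  refine (ae_eq_condExp_of_forall_setIntegral_eq hm h.aebdd.integrable
    (fun _ _ _ => integrable_zero _ _ _) (fun s hs _ => ?_) aestronglyMeasurable_zero).symm
  have := h.integral_aebdd_mul (AEBdd.indicator hs)
  have h2 : ∀ x, s.indicator (fun _ => (1 : ℝ)) x * F x = s.indicator F x := fun x => by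
    by_cases hx : x ∈ s <;> simp [hx]
  simp only [h2] at this
  rw [integral_indicator (hm s hs)] at this
  simp [this]

end CondZero

section

variable {α : Type*} {m m' m0 : MeasurableSpace α} {ν : Measure α} {F : α → ℝ}

lemma integral_mul_condExp [IsFiniteMeasure ν] (hm : m ≤ m0) (hF : Integrable F ν) {ψ : α → ℝ}
    (hψ : Measurable[m] ψ) (hK : ∃ K : ℝ, ∀ x, |ψ x| ≤ K) :
    ∫ x, ψ x * F x ∂ν = ∫ x, ψ x * (ν[F|m]) x ∂ν := by
  obtain ⟨K, hK⟩ := hK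
  rw [← integral_condExp (f := fun x => ψ x * F x) hm]
  refine integral_congr_ae ?_
  exact condExp_stronglyMeasurable_mul_of_bound hm hψ.stronglyMeasurable hF K (ae_of_all _ hK)

lemma exists_condZero_sub [IsFiniteMeasure ν] (hm : m ≤ m0) (hF : AEBdd m0 ν F) :
    ∃ φ : α → ℝ, AEBdd m ν φ ∧ CondZero m ν (fun x => F x - φ x) := by
  have hint := hF.integrable
  obtain ⟨K, hK⟩ := hF.exists_bound
  have hφ : AEBdd m ν (ν[F|m]) :=
    ⟨stronglyMeasurable_condExp.measurable, K, ae_bdd_abs_condExp_of_ae_bdd_abs hK⟩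
  refine ⟨_, hφ, hF.sub (hφ.mono hm), fun ψ hψ hb => ?_⟩
  have h : AEBdd m0 ν ψ := ⟨hψ.mono hm le_rfl, hb.imp fun _ h => ae_of_all _ h⟩
  simp only [mul_sub]
  rw [integral_sub (h.mul hF).integrable (h.mul (hφ.mono hm)).integrable,
    integral_mul_condExp hm hint hψ hb, sub_self]

lemma exists_nonneg_condZero_sub [IsFiniteMeasure ν] (hm : m ≤ m0) (hF : AEBdd m0 ν F)
    (h0 : 0 ≤ᵐ[ν] F) :
    ∃ φ : α → ℝ, AEBdd m ν φ ∧ (∀ x, 0 ≤ φ x) ∧ CondZero m ν (fun x => F x - φ x) := by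
  have hint := hF.integrable
  obtain ⟨K, hK⟩ := hF.exists_bound
  have hφ : AEBdd m ν (ν[F|m]) :=
    ⟨stronglyMeasurable_condExp.measurable, K, ae_bdd_abs_condExp_of_ae_bdd_abs hK⟩
  refine ⟨_, hφ.max_zero, fun x => le_max_right _ _, hF.sub (hφ.max_zero.mono hm),
    fun ψ hψ hb => ?_⟩
  have h : AEBdd m0 ν ψ := ⟨hψ.mono hm le_rfl, hb.imp fun _ h => ae_of_all _ h⟩
  simp only [mul_sub]
  rw [integral_sub (h.mul hF).integrable (h.mul (hφ.max_zero.mono hm)).integrable,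
    integral_mul_condExp hm hint hψ hb, sub_eq_zero]
  refine integral_congr_ae ?_
  filter_upwards [condExp_nonneg (m := m) h0] with x hx
  rw [max_eq_left (by simpa using hx)]

lemma integral_withDensity_ofReal [IsFiniteMeasure ν] {w : α → ℝ} (hw : Measurable w)
    (h0 : 0 ≤ᵐ[ν] w) (F : α → ℝ) :
    ∫ x, F x ∂ν.withDensity (fun x => ENNReal.ofReal (w x)) = ∫ x, w x * F x ∂ν := by
  rw [integral_withDensity_eq_integral_toReal_smul hw.ennreal_ofReal (by simp)]
  refine integral_congr_ae ?_
  filter_upwards [h0] with x hx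
  simp [ENNReal.toReal_ofReal hx]

lemma AEBdd.isFiniteMeasure_withDensity [IsFiniteMeasure ν] {w : α → ℝ} (hw : AEBdd m0 ν w) :
    IsFiniteMeasure (ν.withDensity fun x => ENNReal.ofReal (w x)) :=
  isFiniteMeasure_withDensity_ofReal hw.integrable.2

/-- Transfer of conditional moment restrictions to a reweighted and transported measure. -/
lemma CondZero.map_withDensity [IsFiniteMeasure ν] (hm : m ≤ m0)
    {w : α → ℝ}
    (hw : AEBdd m0 ν w) (h0 : 0 ≤ᵐ[ν] w) {φ : α → α} (hφ : Measurable φ)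
    (hφm : Measurable[m', m] φ) (hF : Measurable F) (hFφ : AEBdd m0 ν (fun x => F (φ x)))
    (h : CondZero m' ν (fun x => w x * F (φ x))) :
    CondZero m ((ν.withDensity fun x => ENNReal.ofReal (w x)).map φ) F := by
  refine ⟨⟨hF, ?_⟩, fun ψ hψ hb => ?_⟩
  · obtain ⟨K, hK⟩ := hFφ.exists_bound
    refine ⟨K, (ae_map_iff hφ.aemeasurable (measurableSet_le hF.abs measurable_const)).2 ?_⟩
    exact (withDensity_absolutelyContinuous _ _).ae_le hK
  · rw [integral_map (f := fun x => ψ x * F x) hφ.aemeasurable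
        ((hψ.mono hm le_rfl).mul hF).aestronglyMeasurable,
      integral_withDensity_ofReal hw.measurable h0,
      ← h.integral_mul (fun x => ψ (φ x)) (hψ.comp hφm) (hb.imp fun _ h x => h _)]
    exact integral_congr_ae (ae_of_all _ fun x => by ring)

end

/-- Coordinates are ordered `(γ, β, Y₀, Y₁, Y₂)`; this is the `σ`-algebra of `(γ, β, Y₀)`. -/
abbrev sigma0 : MeasurableSpace (Fin 5 → ℝ) :=
  MeasurableSpace.comap (fun x => (x 0, x 1, x 2)) inferInstance

/-- The `σ`-algebra of `(γ, β, Y₀, Y₁)`. -/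
abbrev sigma1 : MeasurableSpace (Fin 5 → ℝ) :=
  MeasurableSpace.comap (fun x => (x 0, x 1, x 2, x 3)) inferInstance

lemma sigma1_le : sigma1 ≤ MeasurableSpace.pi :=
  Measurable.comap_le (by fun_prop)

lemma measurable_sigma0_zero : Measurable[sigma0] (fun x : Fin 5 → ℝ => x 0) :=
  measurable_fst.comp (comap_measurable _)

lemma measurable_sigma0_one : Measurable[sigma0] (fun x : Fin 5 → ℝ => x 1) :=
  (measurable_fst.comp measurable_snd).comp (comap_measurable _)

lemma measurable_sigma0_two : Measurable[sigma0] (fun x : Fin 5 → ℝ => x 2) :=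
  (measurable_snd.comp measurable_snd).comp (comap_measurable _)

lemma measurable_sigma1_three : Measurable[sigma1] (fun x : Fin 5 → ℝ => x 3) :=
  ((measurable_snd.comp measurable_snd).comp measurable_snd).comp (comap_measurable _)

lemma sigma0_le_sigma1 : sigma0 ≤ sigma1 := by
  refine Measurable.comap_le ?_
  have : Measurable (fun p : ℝ × ℝ × ℝ × ℝ => (p.1, p.2.1, p.2.2.1)) := by fun_prop
  exact this.comp (comap_measurable _)

lemma sigma0_le : sigma0 ≤ MeasurableSpace.pi :=
  sigma0_le_sigma1.trans sigma1_le

lemma measurable_sigma0_iff {m : MeasurableSpace (Fin 5 → ℝ)}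
    {φ : (Fin 5 → ℝ) → (Fin 5 → ℝ)} (h0 : Measurable[m] fun x => φ x 0)
    (h1 : Measurable[m] fun x => φ x 1) (h2 : Measurable[m] fun x => φ x 2) :
    Measurable[m, sigma0] φ :=
  measurable_comap_iff.2 (h0.prodMk (h1.prodMk h2))

lemma measurable_sigma1_iff {m : MeasurableSpace (Fin 5 → ℝ)}
    {φ : (Fin 5 → ℝ) → (Fin 5 → ℝ)} (h0 : Measurable[m] fun x => φ x 0)
    (h1 : Measurable[m] fun x => φ x 1) (h2 : Measurable[m] fun x => φ x 2)
    (h3 : Measurable[m] fun x => φ x 3) :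
    Measurable[m, sigma1] φ :=
  measurable_comap_iff.2 (h0.prodMk (h1.prodMk (h2.prodMk h3)))

/-- First-period residual `Y₁ - γ - β Y₀`. -/
def resid1 (x : Fin 5 → ℝ) : ℝ := x 3 - x 0 - x 1 * x 2

/-- Second-period residual `Y₂ - γ - β Y₁`. -/
def resid2 (x : Fin 5 → ℝ) : ℝ := x 4 - x 0 - x 1 * x 3

lemma measurable_resid1 : Measurable resid1 := by unfold resid1; fun_prop

lemma measurable_resid2 : Measurable resid2 := by unfold resid2; fun_prop

/-- A bounded law of `(γ, β, Y₀, Y₁, Y₂)` satisfying the conditional moment restrictions. -/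
structure IsModel (ν : Measure (Fin 5 → ℝ)) : Prop where
  coord : ∀ i, AEBdd MeasurableSpace.pi ν (fun x => x i)
  condZero1 : CondZero sigma0 ν resid1
  condZero2 : CondZero sigma1 ν resid2

lemma IsModel.add {ν ν' : Measure (Fin 5 → ℝ)} [IsFiniteMeasure ν] [IsFiniteMeasure ν']
    (h : IsModel ν) (h' : IsModel ν') : IsModel (ν + ν') := by
  refine ⟨fun i => ⟨measurable_pi_apply i, ?_⟩, h.condZero1.add_measure sigma0_le h'.condZero1,
    h.condZero2.add_measure sigma1_le h'.condZero2⟩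
  obtain ⟨K, hK⟩ := (h.coord i).exists_bound
  obtain ⟨L, hL⟩ := (h'.coord i).exists_bound
  refine ⟨max K L, ?_⟩
  rw [ae_add_measure_iff]
  exact ⟨hK.mono fun x hx => hx.trans (le_max_left _ _),
    hL.mono fun x hx => hx.trans (le_max_right _ _)⟩

lemma IsModel.aebdd_resid1 {ν : Measure (Fin 5 → ℝ)} (hν : IsModel ν) :
    AEBdd sigma1 ν resid1 :=
  ⟨(measurable_sigma1_three.sub (measurable_sigma0_zero.mono sigma0_le_sigma1 le_rfl)).sub
    ((measurable_sigma0_one.mul measurable_sigma0_two).mono sigma0_le_sigma1 le_rfl),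
    hν.condZero1.aebdd.exists_bound⟩

lemma volume_eq_zero_of_countable_slices {n : ℕ} (i : Fin (n + 1)) {S : Set (Fin (n + 1) → ℝ)}
    (hS : MeasurableSet S) (h : ∀ y : Fin n → ℝ, {s : ℝ | i.insertNth s y ∈ S}.Countable) :
    volume S = 0 := by
  have e := (volume_preserving_piFinSuccAbove (fun _ : Fin (n + 1) => ℝ) i).symm
  rw [← e.measure_preimage hS.nullMeasurableSet, Measure.volume_eq_prod,
    Measure.prod_apply_symm (e.measurable hS)]
  have : ∀ y : Fin n → ℝ, volume ((fun s : ℝ => (s, y)) ⁻¹'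
      ((MeasurableEquiv.piFinSuccAbove (fun _ : Fin (n + 1) => ℝ) i).symm ⁻¹' S)) = 0 :=
    fun y => (h y).measure_zero _
  rw [lintegral_congr this, lintegral_zero]

lemma ae_quadratic_ne_zero {ν : Measure (Fin 5 → ℝ)} (hν : ν ≪ volume)
    {c0 c1 c2 : (Fin 5 → ℝ) → ℝ} (h0 : Measurable[sigma0] c0) (h1 : Measurable[sigma0] c1)
    (h2 : Measurable[sigma0] c2) :
    ∀ᵐ x ∂ν, c0 x + c1 x * x 3 + c2 x * x 3 ^ 2 = 0 → c0 x = 0 ∧ c1 x = 0 ∧ c2 x = 0 := by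
  obtain ⟨d0, hd0, rfl⟩ := h0.exists_eq_measurable_comp
  obtain ⟨d1, hd1, rfl⟩ := h1.exists_eq_measurable_comp
  obtain ⟨d2, hd2, rfl⟩ := h2.exists_eq_measurable_comp
  refine hν.ae_le ?_
  have hT : Measurable (fun x : Fin 5 → ℝ => (x 0, x 1, x 2)) := by fun_prop
  have m0 := hd0.comp hT
  have m1 := hd1.comp hT
  have m2 := hd2.comp hT
  refine volume_eq_zero_of_countable_slices 3 ?_ fun y => ?_
  · refine (MeasurableSet.imp (measurableSet_eq_fun (by fun_prop) measurable_const)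
      ((measurableSet_eq_fun m0 measurable_const).inter
        ((measurableSet_eq_fun m1 measurable_const).inter
          (measurableSet_eq_fun m2 measurable_const)))).compl
  · have e0 : ∀ s : ℝ, (Fin.insertNth 3 s y : Fin 5 → ℝ) 0 = y 0 := fun s => rfl
    have e1 : ∀ s : ℝ, (Fin.insertNth 3 s y : Fin 5 → ℝ) 1 = y 1 := fun s => rfl
    have e2 : ∀ s : ℝ, (Fin.insertNth 3 s y : Fin 5 → ℝ) 2 = y 2 := fun s => rfl
    have e3 : ∀ s : ℝ, (Fin.insertNth 3 s y : Fin 5 → ℝ) 3 = s := fun s => rfl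
    simp only [Function.comp_apply, Set.mem_compl_iff, Set.mem_ofPred_eq, e0, e1, e2, e3]
    set a := d0 (y 0, y 1, y 2)
    set b := d1 (y 0, y 1, y 2)
    set c := d2 (y 0, y 1, y 2)
    let p : Polynomial ℝ := .C a + .C b * .X + .C c * .X ^ 2
    by_cases hp : p = 0
    · have ha : a = 0 := by simpa [p] using congrArg (fun q => q.coeff 0) hp
      have hb : b = 0 := by
        simpa [p, Polynomial.coeff_X, Polynomial.coeff_C] using congrArg (fun q => q.coeff 1) hp
      have hc : c = 0 := by
        simpa [p, Polynomial.coeff_X, Polynomial.coeff_C] using congrArg (fun q => q.coeff 2) hp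
      simp [ha, hb, hc]
    · refine (p.roots.toFinset.countable_toSet).mono fun s hs => ?_
      rw [Set.mem_ofPred_eq, Classical.not_imp] at hs
      simp only [Finset.mem_coe, Multiset.mem_toFinset, Polynomial.mem_roots hp,
        Polynomial.IsRoot.def]
      simpa [p] using hs.1

lemma ae_resid2_ne_zero {ν : Measure (Fin 5 → ℝ)} (hν : ν ≪ volume) : ∀ᵐ x ∂ν, resid2 x ≠ 0 := by
  refine hν.ae_le (volume_eq_zero_of_countable_slices 4
    (measurableSet_eq_fun measurable_resid2 measurable_const).compl.compl fun y => ?_)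
  refine (Set.countable_singleton (y 0 + y 1 * y 3)).mono fun s hs => ?_
  have : s - y 0 - y 1 * y 3 = 0 := not_not.1 hs
  rw [Set.mem_singleton_iff]
  linarith

lemma ae_resid1_ne_zero {ν : Measure (Fin 5 → ℝ)} (hν : ν ≪ volume) : ∀ᵐ x ∂ν, resid1 x ≠ 0 := by
  refine hν.ae_le (volume_eq_zero_of_countable_slices 3
    (measurableSet_eq_fun measurable_resid1 measurable_const).compl.compl fun y => ?_)
  refine (Set.countable_singleton (y 0 + y 1 * y 2)).mono fun s hs => ?_
  have : s - y 0 - y 1 * y 2 = 0 := not_not.1 hs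
  rw [Set.mem_singleton_iff]
  linarith

/-- `M1, …, M4` are versions of the first four conditional moments of `z` given `m`. -/
structure IsMoments {α : Type*} (m : MeasurableSpace α) {m0 : MeasurableSpace α} (ν : Measure α)
    (z M1 M2 M3 M4 : α → ℝ) : Prop where
  aebdd1 : AEBdd m ν M1
  aebdd2 : AEBdd m ν M2
  aebdd3 : AEBdd m ν M3
  aebdd4 : AEBdd m ν M4
  condZero1 : CondZero m ν (fun x => z x - M1 x)
  condZero2 : CondZero m ν (fun x => z x ^ 2 - M2 x)
  condZero3 : CondZero m ν (fun x => z x ^ 3 - M3 x)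
  condZero4 : CondZero m ν (fun x => z x ^ 4 - M4 x)

section

variable {α : Type*} {m m0 : MeasurableSpace α} {ν : Measure α} {z M1 M2 M3 M4 : α → ℝ}

lemma IsMoments.condZero_polynomial [IsFiniteMeasure ν] (hm : m ≤ m0)
    (h : IsMoments m ν z M1 M2 M3 M4) {c1 c2 c3 c4 : α → ℝ} (h1 : AEBdd m ν c1)
    (h2 : AEBdd m ν c2) (h3 : AEBdd m ν c3) (h4 : AEBdd m ν c4) :
    CondZero m ν (fun x => c1 x * (z x - M1 x) + c2 x * (z x ^ 2 - M2 x) +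
      c3 x * (z x ^ 3 - M3 x) + c4 x * (z x ^ 4 - M4 x)) :=
  (((h.condZero1.mul hm h1).add hm (h.condZero2.mul hm h2)).add hm
    (h.condZero3.mul hm h3)).add hm (h.condZero4.mul hm h4)

lemma ae_eq_zero_of_condZero_sq_sub {F φ : α → ℝ}
    (h : CondZero m ν (fun x => F x ^ 2 - φ x)) [IsFiniteMeasure ν] (hφ : ∀ᵐ x ∂ν, φ x = 0) :
    ∀ᵐ x ∂ν, F x = 0 := by
  have he : (fun x => F x ^ 2 - φ x) =ᵐ[ν] fun x => F x ^ 2 := by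
    filter_upwards [hφ] with x hx
    rw [hx, sub_zero]
  have hint := h.aebdd.integrable.congr he
  have h0 := h.integral_eq_zero
  rw [integral_congr_ae he, integral_eq_zero_iff_of_nonneg (fun x => sq_nonneg _) hint] at h0
  filter_upwards [h0] with x hx
  simpa using hx

lemma IsMoments.ae_quadratic_eq_zero [IsFiniteMeasure ν] (hm : m ≤ m0)
    (h : IsMoments m ν z M1 M2 M3 M4) {k0 k1 k2 : α → ℝ} (h0 : AEBdd m ν k0)
    (h1 : AEBdd m ν k1) (h2 : AEBdd m ν k2)
    (hk : ∀ᵐ x ∂ν, k0 x ^ 2 + 2 * k0 x * k1 x * M1 x + (k1 x ^ 2 + 2 * k0 x * k2 x) * M2 x +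
      2 * k1 x * k2 x * M3 x + k2 x ^ 2 * M4 x = 0) :
    ∀ᵐ x ∂ν, k0 x + k1 x * z x + k2 x * z x ^ 2 = 0 := by
  refine ae_eq_zero_of_condZero_sq_sub (m := m) ?_ hk
  refine (h.condZero_polynomial hm (((AEBdd.const 2).mul h0).mul h1)
    ((h1.pow 2).add (((AEBdd.const 2).mul h0).mul h2)) (((AEBdd.const 2).mul h1).mul h2)
    (h2.pow 2)).congr fun x => ?_
  ring

end

lemma ae_quadratic_sub_ne_zero {ν : Measure (Fin 5 → ℝ)} (hν : ν ≪ volume)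
    {c0 c1 c2 : (Fin 5 → ℝ) → ℝ} (h0 : Measurable[sigma0] c0) (h1 : Measurable[sigma0] c1)
    (h2 : Measurable[sigma0] c2) :
    ∀ᵐ x ∂ν, c0 x + c1 x * (x 3 - x 2) + c2 x * (x 3 - x 2) ^ 2 = 0 →
      c0 x = 0 ∧ c1 x = 0 ∧ c2 x = 0 := by
  have m2 := measurable_sigma0_two
  filter_upwards [ae_quadratic_ne_zero hν
    ((h0.sub (h1.mul m2)).add (h2.mul (m2.mul m2)))
    (h1.sub ((h2.mul m2).add (h2.mul m2))) h2] with x hx h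
  simp only [Pi.add_apply, Pi.sub_apply, Pi.mul_apply] at hx
  obtain ⟨e0, e1, e2⟩ := hx (by rw [← h]; ring)
  refine ⟨?_, ?_, e2⟩
  · simp only [e2, zero_mul, add_zero, sub_zero] at e0 e1
    simpa [e1] using e0
  · simpa [e2] using e1

/-- `M2` times the determinant of the conditional Gram matrix of `1, z, z ^ 2`. -/
def gram (M1 M2 M3 M4 : ℝ) : ℝ :=
  (M2 - M1 ^ 2) * (M2 * M4 - M3 ^ 2) - (M2 ^ 2 - M1 * M3) ^ 2

lemma gram_ne_zero {P : Measure (Fin 5 → ℝ)} [IsFiniteMeasure P] (hP : P ≪ volume) (hP0 : P ≠ 0)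
    {M1 M2 M3 M4 : (Fin 5 → ℝ) → ℝ}
    (h : IsMoments sigma0 P (fun x => x 3 - x 2) M1 M2 M3 M4) :
    ¬ ∀ᵐ x ∂P, gram (M1 x) (M2 x) (M3 x) (M4 x) = 0 := by
  intro hG
  have b1 := h.aebdd1
  have b2 := h.aebdd2
  have b3 := h.aebdd3
  have b4 := h.aebdd4
  have hc : ∀ c : ℝ, AEBdd sigma0 P (fun _ => c) := fun c => AEBdd.const c
  have hW : AEBdd sigma0 P (fun x => M2 x * M4 x - M3 x ^ 2) := (b2.mul b4).sub (b3.pow 2)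
  have hN : AEBdd sigma0 P (fun x => M2 x ^ 2 - M1 x * M3 x) := (b2.pow 2).sub (b1.mul b3)
  have q0 := hW.mul b2
  have q1 := (hN.mul b3).sub (hW.mul b1)
  have q2 := (hN.mul b2).neg
  have hWM : ∀ᵐ x ∂P, (M2 x * M4 x - M3 x ^ 2) * M2 x = 0 := by
    filter_upwards [h.ae_quadratic_eq_zero sigma0_le q0 q1 q2 (by
      filter_upwards [hG] with x hx
      rw [gram] at hx
      linear_combination (M2 x * (M2 x * M4 x - M3 x ^ 2)) * hx),
      ae_quadratic_sub_ne_zero hP q0.measurable q1.measurable q2.measurable] with x h1 h2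
    exact (h2 h1).1
  have hM2 : ∀ᵐ x ∂P, M2 x = 0 := by
    filter_upwards [h.ae_quadratic_eq_zero sigma0_le (hc 0) b3.neg b2 (by
      filter_upwards [hWM] with x hx
      linear_combination hx),
      ae_quadratic_sub_ne_zero hP (hc 0).measurable b3.neg.measurable b2.measurable] with x h1 h2
    exact (h2 h1).2.2
  have hz : ∀ᵐ x ∂P, False := by
    filter_upwards [h.ae_quadratic_eq_zero sigma0_le (hc 0) (hc 1) (hc 0) (by
      filter_upwards [hM2] with x hx
      linear_combination hx),
      ae_quadratic_sub_ne_zero hP (hc 0).measurable (hc 1).measurable (hc 0).measurable]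
      with x h1 h2
    exact one_ne_zero (h2 h1).2.1
  exact hP0 (by simpa [ae_iff] using hz)

/-- Change the coefficients so that the regression line at `y` moves up by `a + b (y - Y₀)`. -/
def shift (a b : (Fin 5 → ℝ) → ℝ) (x : Fin 5 → ℝ) : Fin 5 → ℝ :=
  ![x 0 + a x - b x * x 2, x 1 + b x, x 2, x 3, x 4]

section

variable {a b : (Fin 5 → ℝ) → ℝ}

lemma measurable_shift (ha : Measurable a) (hb : Measurable b) : Measurable (shift a b) := by
  refine measurable_pi_iff.2 fun i => ?_
  fin_cases i <;> simp only [shift] <;> simp <;> fun_prop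

lemma measurable_shift_sigma0 (ha : Measurable[sigma0] a) (hb : Measurable[sigma0] b) :
    Measurable[sigma0, sigma0] (shift a b) :=
  measurable_sigma0_iff ((measurable_sigma0_zero.add ha).sub (hb.mul measurable_sigma0_two))
    (measurable_sigma0_one.add hb) measurable_sigma0_two

lemma measurable_shift_sigma1 (ha : Measurable[sigma0] a) (hb : Measurable[sigma0] b) :
    Measurable[sigma1, sigma1] (shift a b) :=
  measurable_sigma1_iff
    (((measurable_sigma0_zero.add ha).sub (hb.mul measurable_sigma0_two)).mono
      sigma0_le_sigma1 le_rfl)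
    ((measurable_sigma0_one.add hb).mono sigma0_le_sigma1 le_rfl)
    (measurable_sigma0_two.mono sigma0_le_sigma1 le_rfl) measurable_sigma1_three

lemma resid1_shift (x : Fin 5 → ℝ) : resid1 (shift a b x) = resid1 x - a x := by
  simp [resid1, shift]; ring

lemma resid2_shift (x : Fin 5 → ℝ) :
    resid2 (shift a b x) = resid2 x - (a x + b x * (x 3 - x 2)) := by
  simp [resid2, shift]; ring

/-- The law of the shifted coefficients after reweighting by `w`. -/
noncomputable def reweight (P : Measure (Fin 5 → ℝ)) (w a b : (Fin 5 → ℝ) → ℝ) :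
    Measure (Fin 5 → ℝ) :=
  (P.withDensity fun x => ENNReal.ofReal (w x)).map (shift a b)

variable {P : Measure (Fin 5 → ℝ)}

lemma isFiniteMeasure_reweight [IsFiniteMeasure P] {w : (Fin 5 → ℝ) → ℝ}
    (hw : AEBdd MeasurableSpace.pi P w) :
    IsFiniteMeasure (reweight P w a b) := by
  have := hw.isFiniteMeasure_withDensity
  unfold reweight
  infer_instance

lemma aebdd_shift (hP : ∀ i, AEBdd MeasurableSpace.pi P (fun x => x i))
    (ha : AEBdd MeasurableSpace.pi P a) (hb : AEBdd MeasurableSpace.pi P b) (i : Fin 5) :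
    AEBdd MeasurableSpace.pi P (fun x => shift a b x i) := by
  fin_cases i
  · exact ((hP 0).add ha).sub (hb.mul (hP 2))
  · exact (hP 1).add hb
  · exact hP 2
  · exact hP 3
  · exact hP 4

lemma isModel_reweight_of_condZero [IsFiniteMeasure P] {w : (Fin 5 → ℝ) → ℝ} (hP : IsModel P)
    (ha : AEBdd sigma0 P a) (hb : AEBdd sigma0 P b) (hw : AEBdd MeasurableSpace.pi P w)
    (hw0 : 0 ≤ᵐ[P] w)
    (h1 : CondZero sigma0 P (fun x => w x * (resid1 x - a x)))
    (h2 : CondZero sigma1 P (fun x => w x * (resid2 x - (a x + b x * (x 3 - x 2))))) :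
    IsModel (reweight P w a b) := by
  have ha' := ha.mono sigma0_le
  have hb' := hb.mono sigma0_le
  have hs := measurable_shift ha'.measurable hb'.measurable
  refine ⟨fun i => ⟨measurable_pi_apply i, ?_⟩, ?_, ?_⟩
  · obtain ⟨K, hK⟩ := (aebdd_shift hP.coord ha' hb' i).exists_bound
    refine ⟨K, (ae_map_iff hs.aemeasurable
      (measurableSet_le (measurable_pi_apply i).abs measurable_const)).2 ?_⟩
    exact (withDensity_absolutelyContinuous _ _).ae_le hK
  · refine CondZero.map_withDensity sigma0_le hw hw0 hs
      (measurable_shift_sigma0 ha.measurable hb.measurable) measurable_resid1 ?_ ?_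
    · simpa only [resid1_shift] using hP.condZero1.aebdd.sub ha'
    · simpa only [resid1_shift] using h1
  · refine CondZero.map_withDensity sigma1_le hw hw0 hs
      (measurable_shift_sigma1 ha.measurable hb.measurable) measurable_resid2 ?_ ?_
    · simpa only [resid2_shift] using hP.condZero2.aebdd.sub
        (ha'.add (hb'.mul ((hP.coord 3).sub (hP.coord 2))))
    · simpa only [resid2_shift] using h2

lemma aebdd_sub_sigma1 (hP : IsModel P) : AEBdd sigma1 P (fun x => x 3 - x 2) :=
  ⟨measurable_sigma1_three.sub (measurable_sigma0_two.mono sigma0_le_sigma1 le_rfl),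
    ((hP.coord 3).sub (hP.coord 2)).exists_bound⟩

/-- Reweighting by `(1 + ρ) (1 + u θ) / 4`, where `u` is the displacement of the regression line
and `θ` tilts the conditional mean of `Y₂`, preserves the second-period restriction. -/
lemma isModel_reweight_tilt [IsFiniteMeasure P] {θ ρ w : (Fin 5 → ℝ) → ℝ} (hP : IsModel P)
    (hθ : CondZero sigma1 P θ) (hθ' : CondZero sigma1 P (fun x => θ x * resid2 x - 1))
    (ha : AEBdd sigma0 P a) (hb : AEBdd sigma0 P b) (hρ : AEBdd sigma1 P ρ)
    (hw : ∀ x, w x = (1 + ρ x) * (1 + (a x + b x * (x 3 - x 2)) * θ x) / 4) (hw0 : 0 ≤ᵐ[P] w)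
    (h1 : CondZero sigma0 P (fun x => (1 + ρ x) * (resid1 x - a x))) :
    IsModel (reweight P w a b) := by
  have a1 := ha.mono sigma0_le_sigma1
  have b1 := hb.mono sigma0_le_sigma1
  have hz := aebdd_sub_sigma1 hP
  have hu : AEBdd sigma1 P (fun x => a x + b x * (x 3 - x 2)) := a1.add (b1.mul hz)
  have hρ1 : AEBdd sigma1 P (fun x => (1 + ρ x) * (1 / 4)) :=
    ((AEBdd.const 1).add hρ).mul (AEBdd.const _)
  have hr1 := hP.aebdd_resid1
  refine isModel_reweight_of_condZero hP ha hb ?_ hw0 ?_ ?_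
  · rw [funext hw]
    simpa only [div_eq_mul_inv] using ((((AEBdd.const 1).add (hρ.mono sigma1_le)).mul
      ((AEBdd.const 1).add ((hu.mono sigma1_le).mul hθ.aebdd))).mul (AEBdd.const (4⁻¹)))
  · have e1 := h1.mul sigma0_le (AEBdd.const (1 / 4))
    have e2 := (hθ.mul sigma1_le ((hρ1.mul (hr1.sub a1)).mul hu)).mono sigma0_le_sigma1
    refine (e1.add sigma0_le e2).congr fun x => ?_
    rw [hw]
    ring
  · have e1 := hP.condZero2.mul sigma1_le hρ1
    have e2 := hθ'.mul sigma1_le (hρ1.mul hu)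
    have e3 := hθ.mul sigma1_le ((hρ1.mul (hu.pow 2)).neg)
    refine ((e1.add sigma1_le e2).add sigma1_le e3).congr fun x => ?_
    rw [hw]
    ring

lemma map_reweight {w : (Fin 5 → ℝ) → ℝ} (ha : Measurable a) (hb : Measurable b) :
    (reweight P w a b).map (fun x => (x 2, x 3, x 4)) =
      (P.withDensity fun x => ENNReal.ofReal (w x)).map (fun x => (x 2, x 3, x 4)) := by
  rw [reweight, Measure.map_map (by fun_prop) (measurable_shift ha hb)]
  rfl

lemma integral_reweight [IsFiniteMeasure P] {w : (Fin 5 → ℝ) → ℝ} (ha : Measurable a)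
    (hb : Measurable b) (hw : Measurable w) (hw0 : 0 ≤ᵐ[P] w) :
    ∫ x, x 1 ∂(reweight P w a b) = ∫ x, w x * (x 1 + b x) ∂P := by
  rw [reweight, integral_map (measurable_shift ha hb).aemeasurable
    (measurable_pi_apply 1).aestronglyMeasurable, integral_withDensity_ofReal hw hw0]
  rfl

end

lemma IsModel.exists_isMoments {P : Measure (Fin 5 → ℝ)} [IsFiniteMeasure P] (hP : IsModel P) :
    ∃ M1 M2 M3 M4, IsMoments sigma0 P (fun x => x 3 - x 2) M1 M2 M3 M4 ∧
      ∀ x, resid1 x = x 3 - x 2 - M1 x := by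
  have hz : AEBdd MeasurableSpace.pi P (fun x => x 3 - x 2) := (hP.coord 3).sub (hP.coord 2)
  obtain ⟨M2, a2, h2⟩ := exists_condZero_sub sigma0_le (hz.pow 2)
  obtain ⟨M3, a3, h3⟩ := exists_condZero_sub sigma0_le (hz.pow 3)
  obtain ⟨M4, a4, h4⟩ := exists_condZero_sub sigma0_le (hz.pow 4)
  have hr : ∀ x : Fin 5 → ℝ, resid1 x = x 3 - x 2 - (x 0 + x 1 * x 2 - x 2) := fun x => by
    rw [resid1]
    ring
  refine ⟨fun x => x 0 + x 1 * x 2 - x 2, M2, M3, M4,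
    ⟨⟨?_, ?_⟩, a2, a3, a4, hP.condZero1.congr hr, h2, h3, h4⟩, hr⟩
  · exact (measurable_sigma0_zero.add (measurable_sigma0_one.mul measurable_sigma0_two)).sub
      measurable_sigma0_two
  · exact (((hP.coord 0).add ((hP.coord 1).mul (hP.coord 2))).sub (hP.coord 2)).exists_bound

/-- A quadratic polynomial in `z`, with coefficients known given `(γ, β, Y₀)`, whose conditional
moments against `1, z, z ^ 2` are `D, 0, -D` with `D` not almost surely zero. -/
structure IsDesign (P : Measure (Fin 5 → ℝ)) (M1 M2 M3 M4 k0 k1 k2 D : (Fin 5 → ℝ) → ℝ) :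
    Prop where
  aebdd0 : AEBdd sigma0 P k0
  aebdd1 : AEBdd sigma0 P k1
  aebdd2 : AEBdd sigma0 P k2
  aebdd : AEBdd sigma0 P D
  moment0 : ∀ x, k0 x + k1 x * M1 x + k2 x * M2 x = D x
  moment1 : ∀ x, k0 x * M1 x + k1 x * M2 x + k2 x * M3 x = 0
  moment2 : ∀ x, k0 x * M2 x + k1 x * M3 x + k2 x * M4 x = -D x
  ne_zero : ¬ ∀ᵐ x ∂P, D x = 0

lemma IsMoments.exists_isDesign {P : Measure (Fin 5 → ℝ)} [IsFiniteMeasure P] (hP : P ≪ volume)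
    (hP0 : P ≠ 0) {M1 M2 M3 M4 : (Fin 5 → ℝ) → ℝ}
    (h : IsMoments sigma0 P (fun x => x 3 - x 2) M1 M2 M3 M4) :
    ∃ k0 k1 k2 D, IsDesign P M1 M2 M3 M4 k0 k1 k2 D := by
  have b1 := h.aebdd1
  have b2 := h.aebdd2
  have b3 := h.aebdd3
  have b4 := h.aebdd4
  have hV : AEBdd sigma0 P (fun x => M2 x - M1 x ^ 2) := b2.sub (b1.pow 2)
  have hW : AEBdd sigma0 P (fun x => M2 x * M4 x - M3 x ^ 2) := (b2.mul b4).sub (b3.pow 2)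
  have hN : AEBdd sigma0 P (fun x => M2 x ^ 2 - M1 x * M3 x) := (b2.pow 2).sub (b1.mul b3)
  refine ⟨_, _, _, fun x => gram (M1 x) (M2 x) (M3 x) (M4 x), (hW.add hN).mul b2,
    ((hV.add hN).mul b3).sub ((hW.add hN).mul b1), ((hV.add hN).mul b2).neg,
    (hV.mul hW).sub (hN.pow 2), fun x => ?_, fun x => by ring, fun x => ?_,
    gram_ne_zero hP hP0 h⟩ <;>
  · rw [gram]
    ring

/-- Density, with respect to `P`, of the first-period tilt. -/
def tiltDensity (M1 D k : (Fin 5 → ℝ) → ℝ) (s t : ℝ) (x : Fin 5 → ℝ) : ℝ :=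
  s * ((x 3 - x 2) * k x) - t * (D x * (D x + k x * (M1 x * (x 3 - x 2) - 1)))

/-- Upward displacement of the regression line at `Y₀`. -/
def tiltIntercept (D : (Fin 5 → ℝ) → ℝ) (s : ℝ) (x : Fin 5 → ℝ) : ℝ := -(s * D x)

/-- Change of the slope of the regression line. -/
def tiltSlope (M1 D : (Fin 5 → ℝ) → ℝ) (τ s t : ℝ) (x : Fin 5 → ℝ) : ℝ :=
  τ ^ 2 * D x ^ 2 + s * (M1 x * D x) + t

/-- Weight of one of the four pieces into which a law is split. -/
noncomputable def tiltWeight (M1 D k θ : (Fin 5 → ℝ) → ℝ) (τ s t : ℝ) (x : Fin 5 → ℝ) : ℝ :=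
  (1 + tiltDensity M1 D k s t x) *
    (1 + (tiltIntercept D s x + tiltSlope M1 D τ s t x * (x 3 - x 2)) * θ x) / 4

section

variable {P : Measure (Fin 5 → ℝ)} {M1 M2 M3 M4 k0 k1 k2 D : (Fin 5 → ℝ) → ℝ}

lemma IsDesign.condZero_tilt [IsFiniteMeasure P]
    (h : IsMoments sigma0 P (fun x => x 3 - x 2) M1 M2 M3 M4)
    (hr : ∀ x, resid1 x = x 3 - x 2 - M1 x) (hk : IsDesign P M1 M2 M3 M4 k0 k1 k2 D)
    (s t : ℝ) {k : (Fin 5 → ℝ) → ℝ}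
    (hkx : ∀ x, k x = k0 x + k1 x * (x 3 - x 2) + k2 x * (x 3 - x 2) ^ 2) :
    CondZero sigma0 P
      (fun x => (1 + tiltDensity M1 D k s t x) * (resid1 x - tiltIntercept D s x)) := by
  have hs : AEBdd sigma0 P (fun _ => s) := AEBdd.const s
  have ht := (AEBdd.const (m := sigma0) (ν := P) t).mul hk.aebdd
  have h1 : AEBdd sigma0 P (fun _ => 1) := AEBdd.const 1
  have b1 := h.aebdd1
  have r0 := (ht.mul (hk.aebdd.sub hk.aebdd0)).neg
  have r1 := (hs.mul hk.aebdd0).sub (ht.mul ((hk.aebdd0.mul b1).sub hk.aebdd1))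
  have r2 := (hs.mul hk.aebdd1).sub (ht.mul ((hk.aebdd1.mul b1).sub hk.aebdd2))
  have r3 := (hs.mul hk.aebdd2).sub (ht.mul (hk.aebdd2.mul b1))
  have e := b1.sub (hs.mul hk.aebdd)
  refine (h.condZero_polynomial sigma0_le ((h1.add r0).sub (e.mul r1)) (r1.sub (e.mul r2))
    (r2.sub (e.mul r3)) r3).congr fun x => ?_
  have m0 := hk.moment0 x
  have m1 := hk.moment1 x
  have m2 := hk.moment2 x
  rw [tiltDensity, tiltIntercept, hkx, hr]
  linear_combination -((s - t * D x * M1 x) * m2 + t * D x * m1 -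
    (M1 x - s * D x) * (s - t * D x * M1 x) * m1 - (M1 x - s * D x) * t * D x * m0)

lemma exists_tiltWeight_nonneg {θ k : (Fin 5 → ℝ) → ℝ} (hz : AEBdd sigma1 P (fun x => x 3 - x 2))
    (hM : AEBdd sigma1 P M1) (hD : AEBdd sigma1 P D) (hk : AEBdd sigma1 P k)
    (hθ : AEBdd MeasurableSpace.pi P θ) :
    ∃ τ : ℝ, 0 < τ ∧ ∀ s t : ℝ, |s| ≤ τ → |t| ≤ τ → 0 ≤ᵐ[P] tiltWeight M1 D k θ τ s t := by
  have h1 : AEBdd sigma1 P (fun _ => 1) := AEBdd.const 1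
  have hl : AEBdd sigma1 P (fun x => M1 x * (x 3 - x 2) - 1) := (hM.mul hz).sub h1
  obtain ⟨K1, hK1, e1⟩ := (hz.mul hk).exists_one_le_bound
  obtain ⟨K2, hK2, e2⟩ := (hD.mul (hD.add (hk.mul hl))).exists_one_le_bound
  obtain ⟨K3, hK3, e3⟩ := ((((hD.pow 2).mul hz).mono sigma1_le).mul hθ).exists_one_le_bound
  obtain ⟨K4, hK4, e4⟩ := (((hD.mul hl).mono sigma1_le).mul hθ).exists_one_le_bound
  obtain ⟨K5, hK5, e5⟩ := ((hz.mono sigma1_le).mul hθ).exists_one_le_bound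
  have hK : 0 < K1 + K2 + K3 + K4 + K5 := by linarith
  have hτ0 : 0 < (K1 + K2 + K3 + K4 + K5)⁻¹ := inv_pos.2 hK
  have hτ1 : (K1 + K2 + K3 + K4 + K5)⁻¹ * (K1 + K2 + K3 + K4 + K5) = 1 := inv_mul_cancel₀ hK.ne'
  refine ⟨_, hτ0, fun s t hs ht => ?_⟩
  set τ := (K1 + K2 + K3 + K4 + K5)⁻¹
  have hττ : |τ ^ 2| ≤ τ := by
    rw [abs_of_nonneg (by positivity)]
    nlinarith
  have hmul : ∀ {c y K : ℝ}, |c| ≤ τ → |y| ≤ K → |c * y| ≤ τ * K := fun hc hy => by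
    rw [abs_mul]
    exact mul_le_mul hc hy (abs_nonneg _) hτ0.le
  have p1 : 0 < τ * K1 := by positivity
  have p2 : 0 < τ * K2 := by positivity
  have p3 : 0 < τ * K3 := by positivity
  have p4 : 0 < τ * K4 := by positivity
  have p5 : 0 < τ * K5 := by positivity
  filter_upwards [e1, e2, e3, e4, e5] with x e1 e2 e3 e4 e5
  have f1 := abs_le.1 (hmul hs e1)
  have f2 := abs_le.1 (hmul ht e2)
  have f3 := abs_le.1 (hmul hττ e3)
  have f4 := abs_le.1 (hmul hs e4)
  have f5 := abs_le.1 (hmul ht e5)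
  have g1 : 0 ≤ 1 + tiltDensity M1 D k s t x := by
    rw [tiltDensity]
    linarith
  have g2 : 0 ≤ 1 + (tiltIntercept D s x + tiltSlope M1 D τ s t x * (x 3 - x 2)) * θ x := by
    rw [tiltIntercept, tiltSlope]
    linarith
  simp only [Pi.zero_apply, tiltWeight]
  positivity

lemma withDensity_add_ofReal {f g : (Fin 5 → ℝ) → ℝ} (hf : Measurable f) (hf0 : 0 ≤ᵐ[P] f)
    (hg0 : 0 ≤ᵐ[P] g) :
    (P.withDensity fun x => ENNReal.ofReal (f x)) + (P.withDensity fun x => ENNReal.ofReal (g x)) =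
      P.withDensity fun x => ENNReal.ofReal (f x + g x) := by
  rw [← withDensity_add_left hf.ennreal_ofReal]
  refine withDensity_congr_ae ?_
  filter_upwards [hf0, hg0] with x h1 h2
  exact (ENNReal.ofReal_add h1 h2).symm

end

/-- A law of the model under which `Y₂` can be tilted is observationally equivalent to another
law of the model with a larger mean slope. -/
lemma IsModel.exists_split {P : Measure (Fin 5 → ℝ)} [IsFiniteMeasure P] (hac : P ≪ volume)
    (hP0 : P ≠ 0) (hP : IsModel P) {θ : (Fin 5 → ℝ) → ℝ} (hθ : CondZero sigma1 P θ)
    (hθ' : CondZero sigma1 P (fun x => θ x * resid2 x - 1)) :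
    ∃ P' : Measure (Fin 5 → ℝ), IsFiniteMeasure P' ∧ IsModel P' ∧
      P'.map (fun x => (x 2, x 3, x 4)) = P.map (fun x => (x 2, x 3, x 4)) ∧
      ∫ x, x 1 ∂P < ∫ x, x 1 ∂P' := by
  obtain ⟨M1, M2, M3, M4, h, hr⟩ := hP.exists_isMoments
  obtain ⟨k0, k1, k2, D, hk⟩ := h.exists_isDesign hac hP0
  have hz := aebdd_sub_sigma1 hP
  have hkb : AEBdd sigma1 P
      (fun x => k0 x + k1 x * (x 3 - x 2) + k2 x * (x 3 - x 2) ^ 2) :=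
    ((hk.aebdd0.mono sigma0_le_sigma1).add ((hk.aebdd1.mono sigma0_le_sigma1).mul hz)).add
      ((hk.aebdd2.mono sigma0_le_sigma1).mul (hz.pow 2))
  obtain ⟨k, hkx⟩ : ∃ k : (Fin 5 → ℝ) → ℝ, k =
    fun x => k0 x + k1 x * (x 3 - x 2) + k2 x * (x 3 - x 2) ^ 2 := ⟨_, rfl⟩
  rw [← hkx] at hkb
  have hM := h.aebdd1.mono sigma0_le_sigma1
  have hD := hk.aebdd.mono sigma0_le_sigma1
  obtain ⟨τ, hτ, hw0⟩ := exists_tiltWeight_nonneg hz hM hD hkb hθ.aebdd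
  have hρ : ∀ s t, AEBdd sigma1 P (tiltDensity M1 D k s t) := fun s t =>
    ((AEBdd.const s).mul (hz.mul hkb)).sub
      ((AEBdd.const t).mul (hD.mul (hD.add (hkb.mul ((hM.mul hz).sub (AEBdd.const 1))))))
  have ha : ∀ s, AEBdd sigma0 P (tiltIntercept D s) := fun s =>
    ((AEBdd.const s).mul hk.aebdd).neg
  have hb : ∀ s t, AEBdd sigma0 P (tiltSlope M1 D τ s t) := fun s t =>
    (((AEBdd.const (τ ^ 2)).mul (hk.aebdd.pow 2)).add
      ((AEBdd.const s).mul (h.aebdd1.mul hk.aebdd))).add (AEBdd.const t)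
  have hw : ∀ s t, AEBdd MeasurableSpace.pi P (tiltWeight M1 D k θ τ s t) := fun s t => by
    have e1 := ((AEBdd.const 1).add (hρ s t)).mono sigma1_le
    have e2 := (((ha s).mono sigma0_le_sigma1).add
      (((hb s t).mono sigma0_le_sigma1).mul hz)).mono sigma1_le
    unfold tiltWeight
    simpa only [div_eq_mul_inv] using
      (e1.mul ((AEBdd.const 1).add (e2.mul hθ.aebdd))).mul (AEBdd.const (4⁻¹))
  have ha' := fun s => ((ha s).measurable.mono sigma0_le le_rfl)
  have hb' := fun s t => ((hb s t).measurable.mono sigma0_le le_rfl)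
  let Q : ℝ → ℝ → Measure (Fin 5 → ℝ) := fun s t =>
    reweight P (tiltWeight M1 D k θ τ s t) (tiltIntercept D s) (tiltSlope M1 D τ s t)
  have hQf : ∀ s t, IsFiniteMeasure (Q s t) := fun s t => isFiniteMeasure_reweight (hw s t)
  have hQ : ∀ s t, |s| ≤ τ → |t| ≤ τ → IsModel (Q s t) := fun s t hs ht =>
    isModel_reweight_tilt hP hθ hθ' (ha s) (hb s t) (hρ s t) (fun _ => rfl) (hw0 s t hs ht)
      (hk.condZero_tilt h hr s t fun x => by rw [hkx])
  have t1 : |τ| ≤ τ := (abs_of_pos hτ).le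
  have t2 : |-τ| ≤ τ := by rwa [abs_neg]
  have i : ∀ s t, |s| ≤ τ → |t| ≤ τ → Integrable (fun x : Fin 5 → ℝ => x 1) (Q s t) :=
    fun s t hs ht => ((hQ s t hs ht).coord 1).integrable
  refine ⟨(Q τ τ + Q τ (-τ)) + (Q (-τ) τ + Q (-τ) (-τ)), inferInstance,
    ((hQ _ _ t1 t1).add (hQ _ _ t1 t2)).add ((hQ _ _ t2 t1).add (hQ _ _ t2 t2)), ?_, ?_⟩
  · have hY : Measurable (fun x : Fin 5 → ℝ => (x 2, x 3, x 4)) := by fun_prop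
    have w1 := hw0 _ _ t1 t1
    have w2 := hw0 _ _ t1 t2
    have w3 := hw0 _ _ t2 t1
    have w4 := hw0 _ _ t2 t2
    simp only [Measure.map_add _ _ hY, Q, map_reweight (ha' _) (hb' _ _)]
    simp only [← Measure.map_add _ _ hY]
    rw [withDensity_add_ofReal (hw _ _).measurable w1 w2,
      withDensity_add_ofReal (hw _ _).measurable w3 w4,
      withDensity_add_ofReal ((hw _ _).add (hw _ _)).measurable
        (by filter_upwards [w1, w2] with x using add_nonneg)
        (by filter_upwards [w3, w4] with x using add_nonneg)]
    congr 1
    refine (congrArg P.withDensity (funext fun x => ?_)).trans withDensity_one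
    refine (congrArg ENNReal.ofReal ?_).trans ENNReal.ofReal_one
    simp only [tiltWeight, tiltDensity, tiltIntercept, tiltSlope]
    ring
  · have hD2 : AEBdd MeasurableSpace.pi P (fun x => D x ^ 2) := (hk.aebdd.pow 2).mono sigma0_le
    have hA := ((h.condZero1.mul sigma0_le hk.aebdd1).add sigma0_le
      (h.condZero2.mul sigma0_le hk.aebdd2)).mul sigma0_le hk.aebdd
    have hB : ∀ s t, CondZero sigma1 P (fun x => ((1 + tiltDensity M1 D k s t x) *
        (tiltIntercept D s x + tiltSlope M1 D τ s t x * (x 3 - x 2)) *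
        (x 1 + tiltSlope M1 D τ s t x)) * θ x) := fun s t => by
      refine hθ.mul sigma1_le ((((AEBdd.const 1).add (hρ s t)).mul
        (((ha s).mono sigma0_le_sigma1).add (((hb s t).mono sigma0_le_sigma1).mul hz))).mul
        (AEBdd.add ⟨measurable_sigma0_one.mono sigma0_le_sigma1 le_rfl, ?_⟩
          ((hb s t).mono sigma0_le_sigma1)))
      exact (hP.coord 1).exists_bound
    have hB4 := ((hB τ τ).add sigma1_le (hB τ (-τ))).add sigma1_le
      ((hB (-τ) τ).add sigma1_le (hB (-τ) (-τ)))
    have hI : ∀ s t, Integrable (fun x => tiltWeight M1 D k θ τ s t x *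
        (x 1 + tiltSlope M1 D τ s t x)) P := fun s t =>
      ((hw s t).mul ((hP.coord 1).add ((hb s t).mono sigma0_le))).integrable
    have hI2 : ∀ s t, Integrable (fun x => tiltWeight M1 D k θ τ s t x *
        (x 1 + tiltSlope M1 D τ s t x) + tiltWeight M1 D k θ τ s (-t) x *
        (x 1 + tiltSlope M1 D τ s (-t) x)) P := fun s t => (hI s t).add (hI s (-t))
    have hpos : 0 < ∫ x, D x ^ 2 ∂P := by
      rw [integral_pos_iff_support_of_nonneg (fun x => sq_nonneg _) hD2.integrable,
        pos_iff_ne_zero]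
      intro h0
      refine hk.ne_zero (measure_mono_null (fun x hx => ?_) h0)
      simpa using hx
    rw [integral_add_measure ((i _ _ t1 t1).add_measure (i _ _ t1 t2))
        ((i _ _ t2 t1).add_measure (i _ _ t2 t2)),
      integral_add_measure (i _ _ t1 t1) (i _ _ t1 t2),
      integral_add_measure (i _ _ t2 t1) (i _ _ t2 t2)]
    simp only [Q]
    rw [integral_reweight (ha' _) (hb' _ _) (hw _ _).measurable (hw0 _ _ t1 t1),
      integral_reweight (ha' _) (hb' _ _) (hw _ _).measurable (hw0 _ _ t1 t2),
      integral_reweight (ha' _) (hb' _ _) (hw _ _).measurable (hw0 _ _ t2 t1),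
      integral_reweight (ha' _) (hb' _ _) (hw _ _).measurable (hw0 _ _ t2 t2),
      ← integral_add (hI _ _) (hI _ _), ← integral_add (hI _ _) (hI _ _),
      ← integral_add (hI2 _ _) (hI2 _ _)]
    have hsum := integral_add (((hP.coord 1).integrable.add (hD2.integrable.const_mul (τ ^ 2))))
      ((hA.aebdd.integrable.const_mul (τ ^ 2)).add (hB4.aebdd.integrable.const_mul (1 / 4)))
    simp only [Pi.add_apply] at hsum
    rw [integral_add (hP.coord 1).integrable (hD2.integrable.const_mul _),
      integral_add (hA.aebdd.integrable.const_mul _) (hB4.aebdd.integrable.const_mul _),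
      integral_const_mul, integral_const_mul, integral_const_mul, hA.integral_eq_zero,
      hB4.integral_eq_zero] at hsum
    have hpos' : 0 < τ ^ 2 * ∫ x, D x ^ 2 ∂P := by positivity
    refine lt_of_lt_of_eq (b := (∫ x, x 1 ∂P + τ ^ 2 * ∫ x, D x ^ 2 ∂P) + (τ ^ 2 * 0 + 1 / 4 * 0))
      (by linarith) (hsum.symm.trans (integral_congr_ae (ae_of_all _ fun x => ?_)))
    have m0 := hk.moment0 x
    simp only [tiltWeight, tiltDensity, tiltIntercept, tiltSlope, hkx]
    linear_combination (-τ ^ 2 * D x) * m0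

/-- A bounded weight supported on `S` that preserves a zero conditional mean. -/
lemma CondZero.exists_weight {α : Type*} {m m' m0 : MeasurableSpace α} {ν : Measure α}
    [IsFiniteMeasure ν] (hm : m ≤ m') (hm' : m' ≤ m0) {w : α → ℝ} (hw : CondZero m ν w)
    (hwm : Measurable[m'] w) {S : Set α} (hS : MeasurableSet[m'] S)
    (hlt : 2 * ∫ x, Sᶜ.indicator (fun _ => (1 : ℝ)) x * |w x| ∂ν < ∫ x, |w x| ∂ν) :
    ∃ r : α → ℝ, AEBdd m' ν r ∧ (∀ x, 0 ≤ r x) ∧ (∀ᵐ x ∂ν, r x ≤ 1) ∧ (∀ x ∉ S, r x = 0) ∧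
      CondZero m ν (fun x => r x * w x) ∧ ¬ ∀ᵐ x ∂ν, r x = 0 := by
  have hw' : AEBdd m' ν w := ⟨hwm, hw.aebdd.exists_bound⟩
  have hI : AEBdd m' ν (S.indicator fun _ => (1 : ℝ)) := AEBdd.indicator hS
  have hI0 : ∀ x, 0 ≤ S.indicator (fun _ => (1 : ℝ)) x := Set.indicator_nonneg (by simp)
  have hmm := hm.trans hm'
  obtain ⟨p, hp, hp0, hpc⟩ := exists_nonneg_condZero_sub hmm
    ((hI.mul hw'.max_zero).mono hm') (ae_of_all _ fun x => mul_nonneg (hI0 x) (le_max_right _ _))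
  obtain ⟨q, hq, hq0, hqc⟩ := exists_nonneg_condZero_sub hmm
    ((hI.mul hw'.neg.max_zero).mono hm')
    (ae_of_all _ fun x => mul_nonneg (hI0 x) (le_max_right _ _))
  have hpos : AEBdd m' ν ({x | 0 < w x}.indicator fun _ => (1 : ℝ)) :=
    AEBdd.indicator (hwm measurableSet_Ioi)
  have hneg : AEBdd m' ν ({x | w x < 0}.indicator fun _ => (1 : ℝ)) :=
    AEBdd.indicator (hwm measurableSet_Iio)
  have hr := hI.mul (((hq.mono hm).mul hpos).add ((hp.mono hm).mul hneg))
  have hr0 : ∀ x, 0 ≤ S.indicator (fun _ => (1 : ℝ)) x *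
      (q x * {x | 0 < w x}.indicator (fun _ => (1 : ℝ)) x +
        p x * {x | w x < 0}.indicator (fun _ => (1 : ℝ)) x) := fun x =>
    mul_nonneg (hI0 x) (add_nonneg
      (mul_nonneg (hq0 x) (Set.indicator_nonneg (by simp) x))
      (mul_nonneg (hp0 x) (Set.indicator_nonneg (by simp) x)))
  obtain ⟨K, hK, hrK⟩ := hr.exists_one_le_bound
  have hK0 : 0 < K := by linarith
  refine ⟨_, (AEBdd.const K⁻¹).mul hr, fun x => mul_nonneg (inv_pos.2 hK0).le (hr0 x), ?_, ?_, ?_,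
    fun h => ?_⟩
  · filter_upwards [hrK] with x hx
    rw [inv_mul_le_iff₀ hK0, mul_one]
    exact (le_abs_self _).trans hx
  · intro x hx
    simp [hx]
  · refine ((hpc.mul hmm ((AEBdd.const K⁻¹).mul hq)).add hmm
      (hqc.mul hmm ((AEBdd.const K⁻¹).mul hp).neg)).congr fun x => ?_
    rcases lt_trichotomy (w x) 0 with h | h | h
    · simp [h, h.le, h.not_gt]
      ring
    · simp [h]
      ring
    · simp [h, h.le, h.not_gt]
      ring
  · have hqp : ∀ᵐ x ∂ν, q x * p x = 0 := by
      have h1 := (hpc.mul hmm hq).integral_eq_zero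
      have h2 : (fun x => q x * (S.indicator (fun _ => (1 : ℝ)) x * max (w x) 0 - p x)) =ᵐ[ν]
          fun x => -(q x * p x) := by
        filter_upwards [h] with x hx
        have : S.indicator (fun _ => (1 : ℝ)) x *
            (q x * {x | 0 < w x}.indicator (fun _ => (1 : ℝ)) x +
            p x * {x | w x < 0}.indicator (fun _ => (1 : ℝ)) x) = 0 := by
          simpa [hK0.ne'] using hx
        rcases le_or_gt (w x) 0 with h | h
        · simp [h]
        · simp [h, h.le, h.not_gt] at this ⊢
          rcases this with h | h <;> simp [h]
      rw [integral_congr_ae h2, integral_neg, neg_eq_zero, integral_eq_zero_iff_of_nonneg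
        (fun x => mul_nonneg (hq0 x) (hp0 x)) ((hq.mul hp).mono hmm).integrable] at h1
      exact h1
    have hζ : AEBdd m ν ({x | p x = 0}.indicator fun _ => (1 : ℝ)) :=
      AEBdd.indicator (hp.measurable (measurableSet_singleton 0))
    have hζ' : AEBdd m ν (fun x => 1 - {x | p x = 0}.indicator (fun _ => (1 : ℝ)) x) :=
      (AEBdd.const 1).sub hζ
    have c := ((hpc.mul hmm hζ).add hmm (hqc.mul hmm hζ')).add hmm
      (hw.mul hmm (((AEBdd.const (1 / 2)).sub hζ)))
    have habs : Integrable (fun x => |w x|) ν := hw.aebdd.integrable.abs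
    have hC : Integrable (fun x => Sᶜ.indicator (fun _ => (1 : ℝ)) x * |w x|) ν := by
      have := habs.indicator (hm' _ hS.compl)
      refine this.congr (ae_of_all _ fun x => ?_)
      by_cases hx : x ∈ S <;> simp [hx]
    have hle : ∫ x, |w x| ∂ν ≤ ∫ x, 2 * (Sᶜ.indicator (fun _ => (1 : ℝ)) x * |w x|) + 2 *
        ({x | p x = 0}.indicator (fun _ => (1 : ℝ)) x *
          (S.indicator (fun _ => (1 : ℝ)) x * max (w x) 0 - p x) +
        (1 - {x | p x = 0}.indicator (fun _ => (1 : ℝ)) x) *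
          (S.indicator (fun _ => (1 : ℝ)) x * max (-w x) 0 - q x) +
        (1 / 2 - {x | p x = 0}.indicator (fun _ => (1 : ℝ)) x) * w x) ∂ν := by
      refine integral_mono_ae habs ((hC.const_mul 2).add (c.aebdd.integrable.const_mul 2)) ?_
      filter_upwards [hqp] with x hx
      by_cases hpx : p x = 0 <;> by_cases hxS : x ∈ S <;> rcases le_total (w x) 0 with h | h <;>
        simp_all [abs_of_nonneg, abs_of_nonpos] <;> linarith
    rw [integral_add (hC.const_mul 2) (c.aebdd.integrable.const_mul 2), integral_const_mul,
      integral_const_mul, c.integral_eq_zero] at hle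
    linarith

lemma CondZero.withDensity {α : Type*} {m m0 : MeasurableSpace α} {ν : Measure α}
    [IsFiniteMeasure ν] (hm : m ≤ m0) {r F : α → ℝ} (hr : AEBdd m0 ν r) (h0 : 0 ≤ᵐ[ν] r)
    (hF : AEBdd m0 ν F) (h : CondZero m ν (fun x => r x * F x)) :
    CondZero m (ν.withDensity fun x => ENNReal.ofReal (r x)) F := by
  have := CondZero.map_withDensity (m := m) (m' := m) hm hr h0 measurable_id measurable_id
    hF.measurable hF h
  rwa [Measure.map_id] at this

section

variable {ν : Measure (Fin 5 → ℝ)}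

lemma IsModel.withDensity [IsFiniteMeasure ν] (hν : IsModel ν) {r : (Fin 5 → ℝ) → ℝ}
    (hr : AEBdd sigma1 ν r) (h0 : 0 ≤ᵐ[ν] r) (h1 : CondZero sigma0 ν (fun x => r x * resid1 x)) :
    IsModel (ν.withDensity fun x => ENNReal.ofReal (r x)) where
  coord i := (hν.coord i).ac (withDensity_absolutelyContinuous _ _)
  condZero1 := h1.withDensity sigma0_le (hr.mono sigma1_le) h0 hν.condZero1.aebdd
  condZero2 := (hν.condZero2.mul sigma1_le hr).withDensity sigma1_le (hr.mono sigma1_le) h0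
    hν.condZero2.aebdd

/-- The conditional variance of the second-period residual is almost surely positive. -/
lemma ae_pos_of_condZero_resid2_sq [IsFiniteMeasure ν] (hac : ν ≪ volume)
    {v : (Fin 5 → ℝ) → ℝ} (hv : AEBdd sigma1 ν v) (hv0 : ∀ x, 0 ≤ v x)
    (h : CondZero sigma1 ν (fun x => resid2 x ^ 2 - v x)) : ∀ᵐ x ∂ν, 0 < v x := by
  have hS : AEBdd sigma1 ν ({x | v x = 0}.indicator fun _ => (1 : ℝ)) :=
    AEBdd.indicator (hv.measurable (measurableSet_singleton 0))
  have h' : CondZero sigma1 ν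
      (fun x => ({x | v x = 0}.indicator (fun _ => (1 : ℝ)) x * resid2 x) ^ 2 - 0) := by
    refine (h.mul sigma1_le hS).congr fun x => ?_
    by_cases hx : v x = 0 <;> simp [hx]
  filter_upwards [ae_eq_zero_of_condZero_sq_sub h' (ae_of_all _ fun _ => rfl),
    ae_resid2_ne_zero hac] with x h1 h2
  refine lt_of_le_of_ne (hv0 x) fun h3 => h2 ?_
  simpa [h3.symm] using h1

lemma exists_pos_two_mul_integral_lt [IsFiniteMeasure ν] {v g : (Fin 5 → ℝ) → ℝ}
    (hv : Measurable v) (hpos : ∀ᵐ x ∂ν, 0 < v x) (hg : Integrable g ν)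
    (hgpos : 0 < ∫ x, g x ∂ν) :
    ∃ ε : ℝ, 0 < ε ∧ 2 * ∫ x, {x | ε ≤ v x}ᶜ.indicator (fun _ => (1 : ℝ)) x * g x ∂ν <
      ∫ x, g x ∂ν := by
  let ε : ℕ → ℝ := fun n => 1 / ((n : ℝ) + 1)
  have hε : Antitone ε := fun i j hij => Nat.one_div_le_one_div hij
  have hm : ∀ n, MeasurableSet {x | ε n ≤ v x}ᶜ := fun n =>
    (measurableSet_le measurable_const hv).compl
  have ht := tendsto_setIntegral_of_antitone (μ := ν) (f := g) hm (fun i j hij x hx hx' =>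
    hx ((hε hij).trans hx')) ⟨0, hg.integrableOn⟩
  have h0 : ν (⋂ n, {x | ε n ≤ v x}ᶜ) = 0 := by
    refine measure_eq_zero_iff_ae_notMem.2 (hpos.mono fun x hx' hx => ?_)
    obtain ⟨n, hn⟩ := exists_nat_one_div_lt hx'
    exact Set.mem_iInter.1 hx n hn.le
  rw [setIntegral_measure_zero _ h0] at ht
  obtain ⟨n, hn⟩ := (ht.eventually_lt_const (half_pos hgpos)).exists
  refine ⟨ε n, Nat.one_div_pos_of_nat, ?_⟩
  have : ∀ x, {x | ε n ≤ v x}ᶜ.indicator (fun _ => (1 : ℝ)) x * g x =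
      {x | ε n ≤ v x}ᶜ.indicator g x := fun x => by
    by_cases hx : ε n ≤ v x <;> simp [hx]
  simp only [this]
  rw [integral_indicator (hm n)]
  linarith

/-- Every nonzero absolutely continuous law of the model contains a nonzero piece on which
the conditional variance of the second-period residual is bounded away from zero. -/
lemma IsModel.exists_tiltable [IsFiniteMeasure ν] (hac : ν ≪ volume) (hν0 : ν ≠ 0)
    (hν : IsModel ν) :
    ∃ r θ : (Fin 5 → ℝ) → ℝ, AEBdd sigma1 ν r ∧ (∀ x, 0 ≤ r x) ∧ (∀ᵐ x ∂ν, r x ≤ 1) ∧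
      CondZero sigma0 ν (fun x => r x * resid1 x) ∧ (¬ ∀ᵐ x ∂ν, r x = 0) ∧
      CondZero sigma1 (ν.withDensity fun x => ENNReal.ofReal (r x)) θ ∧
      CondZero sigma1 (ν.withDensity fun x => ENNReal.ofReal (r x))
        (fun x => θ x * resid2 x - 1) := by
  obtain ⟨v, hv, hv0, hvc⟩ := exists_nonneg_condZero_sub sigma1_le
    (hν.condZero2.aebdd.pow 2) (ae_of_all _ fun x => sq_nonneg _)
  have hvpos := ae_pos_of_condZero_resid2_sq hac hv hv0 hvc
  have habs : Integrable (fun x => |resid1 x|) ν := hν.condZero1.aebdd.integrable.abs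
  have hres : 0 < ∫ x, |resid1 x| ∂ν := by
    rw [integral_pos_iff_support_of_nonneg (fun x => abs_nonneg _) habs, pos_iff_ne_zero]
    intro h0
    refine hν0 ?_
    have : ∀ᵐ x ∂ν, False := by
      filter_upwards [ae_resid1_ne_zero hac, measure_eq_zero_iff_ae_notMem.1 h0] with x h1 h2
      exact h2 (by simpa using h1)
    simpa [ae_iff] using this
  obtain ⟨ε, hε, hlt⟩ := exists_pos_two_mul_integral_lt
    (hv.measurable.mono sigma1_le le_rfl) hvpos habs hres
  obtain ⟨r, hr, hr0, hr1, hrS, hrc, hrne⟩ := hν.condZero1.exists_weight sigma0_le_sigma1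
    sigma1_le hν.aebdd_resid1.measurable (S := {x | ε ≤ v x})
    (hv.measurable measurableSet_Ici) hlt
  have hmax : ∀ x, 0 < max (v x) ε := fun x => lt_max_of_lt_right hε
  have hc : AEBdd sigma1 ν (fun x => (max (v x) ε)⁻¹) := by
    refine ⟨(hv.measurable.max measurable_const).inv, ε⁻¹, ae_of_all _ fun x => ?_⟩
    rw [abs_of_pos (inv_pos.2 (hmax x))]
    exact inv_anti₀ hε (le_max_right _ _)
  have hθ := hν.condZero2.mul sigma1_le hc
  refine ⟨r, fun x => (max (v x) ε)⁻¹ * resid2 x, hr, hr0, hr1, hrc, hrne, ?_, ?_⟩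
  · exact (hθ.mul sigma1_le hr).withDensity sigma1_le (hr.mono sigma1_le) (ae_of_all _ hr0)
      hθ.aebdd
  · refine CondZero.withDensity sigma1_le (hr.mono sigma1_le) (ae_of_all _ hr0)
      ((hθ.aebdd.mul hν.condZero2.aebdd).sub (AEBdd.const 1))
      ((hvc.mul sigma1_le (hr.mul hc)).congr fun x => ?_)
    by_cases hx : ε ≤ v x
    · have := hε.trans_le hx
      simp only [max_eq_left hx]
      field_simp
    · simp [hrS x hx]

/-- An absolutely continuous probability law of the model is observationally equivalent to another
law of the model with a larger mean slope. -/
lemma IsModel.exists_larger_mean [IsProbabilityMeasure ν] (hac : ν ≪ volume) (hν : IsModel ν) :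
    ∃ ν' : Measure (Fin 5 → ℝ), IsProbabilityMeasure ν' ∧ IsModel ν' ∧
      ν'.map (fun x => (x 2, x 3, x 4)) = ν.map (fun x => (x 2, x 3, x 4)) ∧
      ∫ x, x 1 ∂ν < ∫ x, x 1 ∂ν' := by
  obtain ⟨r, θ, hr, hr0, hr1, hrc, hrne, hθ, hθ'⟩ :=
    hν.exists_tiltable hac (IsProbabilityMeasure.ne_zero ν)
  have hY : Measurable (fun x : Fin 5 → ℝ => (x 2, x 3, x 4)) := by fun_prop
  have hr' : AEBdd sigma1 ν (fun x => 1 - r x) := (AEBdd.const 1).sub hr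
  have h0 : 0 ≤ᵐ[ν] r := ae_of_all _ hr0
  have h0' : 0 ≤ᵐ[ν] fun x => 1 - r x := by
    filter_upwards [hr1] with x hx
    exact sub_nonneg.2 hx
  have hrc' : CondZero sigma0 ν (fun x => (1 - r x) * resid1 x) :=
    (hν.condZero1.add sigma0_le (hrc.mul sigma0_le (AEBdd.const (-1)))).congr fun x => by ring
  have hR := hν.withDensity hr' h0' hrc'
  have hP := hν.withDensity hr h0 hrc
  have hRf := (hr'.mono sigma1_le).isFiniteMeasure_withDensity
  have hPf := (hr.mono sigma1_le).isFiniteMeasure_withDensity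
  have hsum := withDensity_add_ofReal (hr'.mono sigma1_le).measurable h0' h0
  simp only [sub_add_cancel, ENNReal.ofReal_one, withDensity_const, one_smul] at hsum
  set R := ν.withDensity fun x => ENNReal.ofReal (1 - r x)
  have hP0 : ν.withDensity (fun x => ENNReal.ofReal (r x)) ≠ 0 := by
    rw [Ne, withDensity_eq_zero_iff (hr.mono sigma1_le).measurable.ennreal_ofReal.aemeasurable]
    intro h
    refine hrne ?_
    filter_upwards [h] with x hx
    exact le_antisymm (ENNReal.ofReal_eq_zero.1 hx) (hr0 x)
  have hPac : ν.withDensity (fun x => ENNReal.ofReal (r x)) ≪ volume :=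
    (withDensity_absolutelyContinuous _ _).trans hac
  obtain ⟨P', hP'f, hP', hmap, hlt⟩ := hP.exists_split hPac hP0 hθ hθ'
  have hmap' : (R + P').map (fun x => (x 2, x 3, x 4)) = ν.map (fun x => (x 2, x 3, x 4)) := by
    rw [Measure.map_add _ _ hY, hmap, ← Measure.map_add _ _ hY, hsum]
  refine ⟨R + P', ?_, hR.add hP', hmap', ?_⟩
  · have hmass := congrArg (fun κ => κ Set.univ) hmap'
    exact ⟨by simpa [Measure.map_apply hY MeasurableSet.univ] using hmass⟩
  · rw [← hsum, integral_add_measure (hR.coord 1).integrable (hP.coord 1).integrable,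
      integral_add_measure (hR.coord 1).integrable (hP'.coord 1).integrable]
    linarith

end

lemma CondZero.of_condExp_eq_zero {Ω α : Type*} {mG mΩ : MeasurableSpace Ω}
    {m m0 : MeasurableSpace α} {μ : Measure Ω} [IsFiniteMeasure μ] {G : Ω → α} (hm : m ≤ m0)
    (hG : Measurable G) (hmG : mG ≤ mΩ) (hGm : Measurable[mG, m] G) {F : α → ℝ}
    (hF : AEBdd m0 (μ.map G) F) (h : μ[fun ω => F (G ω)|mG] =ᵐ[μ] 0) :
    CondZero m (μ.map G) F := by
  refine ⟨hF, fun ψ hψ hb => ?_⟩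
  rw [integral_map (f := fun x => ψ x * F x) hG.aemeasurable
    ((hψ.mono hm le_rfl).mul hF.measurable).aestronglyMeasurable,
    integral_mul_condExp (F := fun ω => F (G ω)) (ψ := fun ω => ψ (G ω)) hmG
      (hF.integrable.comp_measurable hG) (hψ.comp hGm) (hb.imp fun _ h ω => h _),
    integral_eq_zero_of_ae]
  filter_upwards [h] with ω hω
  simp [hω]

/-- **Failure of point identification in the heterogeneous-coefficient AR(1) model.**
If `(γ, β, Y₀, Y₁, Y₂)` takes values in a compact set `C ⊂ ℝ⁵`, has a joint law that is
absolutely continuous with respect to Lebesgue measure with a density strictly positive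
on `C`, and satisfies the two conditional moment restrictions of the model, then there is
an observationally equivalent model (same joint law of `(Y₀, Y₁, Y₂)`, same conditional
moment restrictions) whose coefficient `β̃` has a strictly larger mean. -/
theorem ar1_mean_not_point_identified
    {Ω : Type*} [MeasurableSpace Ω] (μ : Measure Ω) [IsProbabilityMeasure μ]
    (γ β Y0 Y1 Y2 : Ω → ℝ)
    (hγ : Measurable γ) (hβ : Measurable β) (hY0 : Measurable Y0)
    (hY1 : Measurable Y1) (hY2 : Measurable Y2)
    (C : Set (Fin 5 → ℝ)) (hC : IsCompact C)
    (hsupp : ∀ᵐ ω ∂μ, ![γ ω, β ω, Y0 ω, Y1 ω, Y2 ω] ∈ C)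
    (f : (Fin 5 → ℝ) → ℝ≥0∞)
    (hf : Measure.map (fun ω => ![γ ω, β ω, Y0 ω, Y1 ω, Y2 ω]) μ =
      MeasureTheory.volume.withDensity f)
    (hfpos : ∀ x ∈ C, 0 < f x)
    (h1 : μ[(fun ω => Y1 ω - γ ω - β ω * Y0 ω)|
      MeasurableSpace.comap (fun ω => (γ ω, β ω, Y0 ω)) inferInstance] =ᵐ[μ] 0)
    (h2 : μ[(fun ω => Y2 ω - γ ω - β ω * Y1 ω)|
      MeasurableSpace.comap (fun ω => (γ ω, β ω, Y0 ω, Y1 ω)) inferInstance] =ᵐ[μ] 0) :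
    ∃ (Ω' : Type) (_ : MeasurableSpace Ω') (μ' : Measure Ω') (_ : IsProbabilityMeasure μ')
      (γ' β' Y0' Y1' Y2' : Ω' → ℝ),
      Measurable γ' ∧ Measurable β' ∧ Measurable Y0' ∧ Measurable Y1' ∧ Measurable Y2' ∧
      (μ'[(fun ω => Y1' ω - γ' ω - β' ω * Y0' ω)|
        MeasurableSpace.comap (fun ω => (γ' ω, β' ω, Y0' ω)) inferInstance] =ᵐ[μ'] 0) ∧
      (μ'[(fun ω => Y2' ω - γ' ω - β' ω * Y1' ω)|
        MeasurableSpace.comap (fun ω => (γ' ω, β' ω, Y0' ω, Y1' ω)) inferInstance] =ᵐ[μ'] 0) ∧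
      Measure.map (fun ω => (Y0' ω, Y1' ω, Y2' ω)) μ' =
        Measure.map (fun ω => (Y0 ω, Y1 ω, Y2 ω)) μ ∧
      ∫ ω, β ω ∂μ < ∫ ω, β' ω ∂μ' := by
  set G : Ω → Fin 5 → ℝ := fun ω => ![γ ω, β ω, Y0 ω, Y1 ω, Y2 ω]
  have hG : Measurable G := by
    refine measurable_pi_iff.2 fun i => ?_
    fin_cases i <;> assumption
  have hprob : IsProbabilityMeasure (μ.map G) := Measure.isProbabilityMeasure_map hG.aemeasurable
  have hac : μ.map G ≪ volume := hf ▸ withDensity_absolutelyContinuous _ _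
  obtain ⟨K, hK⟩ := hC.isBounded.exists_norm_le
  have hcoord : ∀ i, AEBdd MeasurableSpace.pi (μ.map G) (fun x => x i) := fun i => by
    refine ⟨measurable_pi_apply i, K, (ae_map_iff hG.aemeasurable
      (measurableSet_le (measurable_pi_apply i).abs measurable_const)).2 ?_⟩
    filter_upwards [hsupp] with ω hω
    exact (norm_le_pi_norm (G ω) i).trans (hK _ hω)
  have hG0 : Measurable fun ω => (γ ω, β ω, Y0 ω) := by fun_prop
  have hG1 : Measurable fun ω => (γ ω, β ω, Y0 ω, Y1 ω) := by fun_prop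
  have hmodel : IsModel (μ.map G) := by
    refine ⟨hcoord, ?_, ?_⟩
    · exact CondZero.of_condExp_eq_zero sigma0_le hG hG0.comap_le
        (measurable_comap_iff.2 (comap_measurable fun ω => (γ ω, β ω, Y0 ω)))
        (((hcoord 3).sub (hcoord 0)).sub ((hcoord 1).mul (hcoord 2))) h1
    · exact CondZero.of_condExp_eq_zero sigma1_le hG hG1.comap_le
        (measurable_comap_iff.2 (comap_measurable fun ω => (γ ω, β ω, Y0 ω, Y1 ω)))
        (((hcoord 4).sub (hcoord 0)).sub ((hcoord 1).mul (hcoord 3))) h2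
  obtain ⟨ν, hν, hνm, hmap, hlt⟩ := hmodel.exists_larger_mean hac
  refine ⟨Fin 5 → ℝ, inferInstance, ν, hν, fun x => x 0, fun x => x 1, fun x => x 2,
    fun x => x 3, fun x => x 4, measurable_pi_apply _, measurable_pi_apply _,
    measurable_pi_apply _, measurable_pi_apply _, measurable_pi_apply _,
    hνm.condZero1.condExp_eq_zero sigma0_le, hνm.condZero2.condExp_eq_zero sigma1_le, ?_, ?_⟩
  · rw [hmap, Measure.map_map (by fun_prop) hG]
    rfl
  · rwa [integral_map hG.aemeasurable (measurable_pi_apply 1).aestronglyMeasurable] at hlt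
end

section
/- Under the linear panel data model with heterogeneous (random) coefficients, suppose Assumption 1 and Assumption 2 hold, fix e ∈ ℝ^r, and assume all of the following expectations exist and are finite: E(e'B), E(R'R), E((R'R)⁻¹), E(R'Y), E((R'R)⁻¹R'Y), E(Y'R(R'R)⁻¹R'Y), and E((R_t'B)ε_t) for each t. Define B̂ = (R'R)⁻¹R'Y, B₀ = E(R'R)⁻¹E(R'Y), 𝓑_R = ½ e'E(B̂) + ½ e'B₀, 𝓔_R = e'E((R'R)⁻¹)e − e'E(R'R)⁻¹e, and 𝓓_R = E(Y'R(R'R)⁻¹R'Y) − E(Y'R)E(R'R)⁻¹E(R'Y). Then: (i) 𝓑_R − ½√(𝓔_R 𝓓_R) ≤ E(e'B) ≤ 𝓑_R + ½√(𝓔_R 𝓓_R); (ii) 𝓔_R ≥ 0 and 𝓓_R ≥ 0; and (iii) 𝓔_R = 0 if and only if the random vector (R'R)⁻¹e is almost surely equal to a constant vector, and 𝓓_R = 0 if and only if the random vector (R'R)⁻¹R'Y is almost surely equal to a constant vector. -/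
open MeasureTheory Matrix

noncomputable section

/-- Entrywise expectation of a random matrix. -/
def EMat {Ω : Type*} [MeasurableSpace Ω] (μ : Measure Ω) {m n : Type*}
    (F : Ω → Matrix m n ℝ) : Matrix m n ℝ :=
  Matrix.of fun i j => ∫ ω, F ω i j ∂μ

/-- Entrywise expectation of a random vector. -/
def EVec {Ω : Type*} [MeasurableSpace Ω] (μ : Measure Ω) {n : Type*}
    (v : Ω → n → ℝ) : n → ℝ :=
  fun i => ∫ ω, v ω i ∂μ

/-- Pull-out property for a finite sum of products of which only the total is assumed
integrable. -/
theorem condExp_sum_mul_of_stronglyMeasurable {Ω ι : Type*} [Fintype ι]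
    {m mΩ : MeasurableSpace Ω} {μ : Measure Ω} [IsFiniteMeasure μ] (hm : m ≤ mΩ)
    {a ε : ι → Ω → ℝ} (ha : ∀ i, StronglyMeasurable[m] (a i)) (hε : ∀ i, Integrable (ε i) μ)
    (hsum : Integrable (fun ω => ∑ i, a i ω * ε i ω) μ) :
    μ[fun ω => ∑ i, a i ω * ε i ω | m] =ᵐ[μ] fun ω => ∑ i, a i ω * (μ[ε i | m]) ω := by
  let A : ℕ → Set Ω := fun k => {ω | ∀ i, ‖a i ω‖ ≤ k}
  have hA : ∀ k, MeasurableSet[m] (A k) := fun k => by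
    have : A k = ⋂ i, {ω | ‖a i ω‖ ≤ k} := by ext; simp [A]
    rw [this]
    exact MeasurableSet.iInter fun i => (ha i).norm.measurable measurableSet_Iic
  have hbound : ∀ k i ω, ‖(A k).indicator (a i) ω‖ ≤ k := fun k i ω => by
    by_cases hω : ω ∈ A k
    · simpa [hω] using hω i
    · simp [hω]
  have hind : ∀ k i, StronglyMeasurable[m] ((A k).indicator (a i)) := fun k i =>
    (ha i).indicator (hA k)
  have key : ∀ k, (A k).indicator (μ[fun ω => ∑ i, a i ω * ε i ω | m]) =ᵐ[μ]
      fun ω => ∑ i, (A k).indicator (a i) ω * (μ[ε i | m]) ω := fun k => by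
    have h1 := condExp_indicator hsum (hA k)
    have h2 : (A k).indicator (fun ω => ∑ i, a i ω * ε i ω)
        = ∑ i, (A k).indicator (a i) * ε i := by
      ext ω
      by_cases hω : ω ∈ A k <;> simp [hω]
    have h3 : μ[∑ i, (A k).indicator (a i) * ε i | m] =ᵐ[μ]
        ∑ i, μ[(A k).indicator (a i) * ε i | m] :=
      condExp_finsetSum (fun i _ => (hε i).bdd_mul
        ((hind k i).mono hm).aestronglyMeasurable
        (Filter.Eventually.of_forall (hbound k i))) m
    have h4 : ∀ᵐ ω ∂μ, ∀ i, (μ[(A k).indicator (a i) * ε i | m]) ω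
        = ((A k).indicator (a i) * μ[ε i | m]) ω :=
      ae_all_iff.2 fun i => condExp_stronglyMeasurable_mul_of_bound hm (hind k i) (hε i) k
        (Filter.Eventually.of_forall (hbound k i))
    rw [h2] at h1
    filter_upwards [h1, h3, h4] with ω h1 h3 h4
    rw [← h1, h3, Finset.sum_apply]
    exact Finset.sum_congr rfl fun i _ => h4 i
  filter_upwards [ae_all_iff.2 key] with ω hω
  obtain ⟨k, hk⟩ := exists_nat_ge (∑ i, ‖a i ω‖)
  have hmem : ω ∈ A k := fun i =>
    (Finset.single_le_sum (f := fun i => ‖a i ω‖) (fun _ _ => norm_nonneg _)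
      (Finset.mem_univ i)).trans hk
  simpa [hmem] using hω k

/-- A sum of predictable multiples of sequentially centred errors has mean zero as soon as the
sum itself is integrable. -/
theorem integral_sum_mul_eq_zero_of_condExp_eq_zero {Ω : Type*} {mΩ : MeasurableSpace Ω}
    {μ : Measure Ω} [IsFiniteMeasure μ] {n : ℕ} {ℱ : Fin n → MeasurableSpace Ω}
    (hmono : Monotone ℱ) (hle : ∀ t, ℱ t ≤ mΩ) {a ε : Fin n → Ω → ℝ}
    (ha : ∀ t, StronglyMeasurable[ℱ t] (a t)) (hε : ∀ t, Integrable (ε t) μ)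
    (hce : ∀ t, μ[ε t | ℱ t] =ᵐ[μ] 0)
    (hsum : Integrable (fun ω => ∑ t, a t ω * ε t ω) μ) :
    ∫ ω, ∑ t, a t ω * ε t ω ∂μ = 0 := by
  induction n with
  | zero => simp
  | succ n ih =>
    have hlast : ∀ t, ℱ t ≤ ℱ (Fin.last n) := fun t => hmono (Fin.le_last t)
    have hpull : μ[fun ω => ∑ t, a t ω * ε t ω | ℱ (Fin.last n)] =ᵐ[μ]
        fun ω => ∑ t : Fin n, a t.castSucc ω * (μ[ε t.castSucc | ℱ (Fin.last n)]) ω := by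
      filter_upwards [condExp_sum_mul_of_stronglyMeasurable (hle _)
        (fun t => (ha t).mono (hlast t)) hε hsum, hce (Fin.last n)] with ω h1 h2
      rw [h1, Fin.sum_univ_castSucc, h2]
      simp
    rw [← integral_condExp (hle (Fin.last n)), integral_congr_ae hpull]
    exact ih (ℱ := fun t => ℱ t.castSucc) (fun s t hst => hmono (by simpa using hst))
      (fun t => hle _) (fun t => ha _) (fun t => integrable_condExp)
      (fun t => (condExp_condExp_of_le (hlast _) (hle _)).trans (hce _))
      (integrable_condExp.congr hpull)

/-- `f` is integrable with mean `a`. -/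
def HasMean {Ω : Type*} [MeasurableSpace Ω] (μ : Measure Ω) (f : Ω → ℝ) (a : ℝ) : Prop :=
  Integrable f μ ∧ ∫ ω, f ω ∂μ = a

namespace HasMean

variable {Ω : Type*} [MeasurableSpace Ω] {μ : Measure Ω} {f g : Ω → ℝ} {a b : ℝ}

theorem add (hf : HasMean μ f a) (hg : HasMean μ g b) :
    HasMean μ (fun ω => f ω + g ω) (a + b) :=
  ⟨hf.1.add hg.1, by rw [integral_add hf.1 hg.1, hf.2, hg.2]⟩

theorem sub (hf : HasMean μ f a) (hg : HasMean μ g b) :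
    HasMean μ (fun ω => f ω - g ω) (a - b) :=
  ⟨hf.1.sub hg.1, by rw [integral_sub hf.1 hg.1, hf.2, hg.2]⟩

theorem const_mul (c : ℝ) (hf : HasMean μ f a) : HasMean μ (fun ω => c * f ω) (c * a) :=
  ⟨hf.1.const_mul c, by rw [integral_const_mul, hf.2]⟩

theorem const [IsProbabilityMeasure μ] (c : ℝ) : HasMean μ (fun _ => c) c :=
  ⟨integrable_const c, by simp⟩

theorem sum {ι : Type*} {s : Finset ι} {f : ι → Ω → ℝ} {a : ι → ℝ}
    (h : ∀ i ∈ s, HasMean μ (f i) (a i)) : HasMean μ (fun ω => ∑ i ∈ s, f i ω) (∑ i ∈ s, a i) :=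
  ⟨integrable_finsetSum s fun i hi => (h i hi).1, by
    rw [integral_finsetSum s fun i hi => (h i hi).1]
    exact Finset.sum_congr rfl fun i hi => (h i hi).2⟩

theorem congr (hf : HasMean μ f a) (hfg : f =ᵐ[μ] g) : HasMean μ g a :=
  ⟨hf.1.congr hfg, by rw [← integral_congr_ae hfg, hf.2]⟩

theorem nonneg (hf : HasMean μ f a) (h : 0 ≤ᵐ[μ] f) : 0 ≤ a :=
  hf.2 ▸ integral_nonneg_of_ae h

theorem eq_zero_iff (hf : HasMean μ f a) (h : 0 ≤ᵐ[μ] f) : a = 0 ↔ f =ᵐ[μ] 0 := by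
  rw [← hf.2, integral_eq_zero_iff_of_nonneg_ae h hf.1]

theorem dotProduct {n : Type*} [Fintype n] {v : Ω → n → ℝ}
    (hv : ∀ i, Integrable (fun ω => v ω i) μ) (c : n → ℝ) :
    HasMean μ (fun ω => c ⬝ᵥ v ω) (c ⬝ᵥ EVec μ v) :=
  sum fun i _ => const_mul (c i) ⟨hv i, rfl⟩

theorem dotProduct_mulVec {n : Type*} [Fintype n] {F : Ω → Matrix n n ℝ}
    (hF : ∀ i j, Integrable (fun ω => F ω i j) μ) (c d : n → ℝ) :
    HasMean μ (fun ω => c ⬝ᵥ F ω *ᵥ d) (c ⬝ᵥ EMat μ F *ᵥ d) := by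
  refine sum fun i _ => const_mul (c i) (sum fun j _ => ?_)
  simpa only [mul_comm _ (d j), EMat, of_apply] using
    const_mul (d j) (⟨hF i j, rfl⟩ : HasMean μ (fun ω => F ω i j) (∫ ω, F ω i j ∂μ))

end HasMean

section PosDef

variable {n : Type*} [Fintype n] {M : Matrix n n ℝ}

theorem Matrix.PosDef.dotProduct_mulVec_comm_real (hM : M.PosDef) (x y : n → ℝ) :
    x ⬝ᵥ M *ᵥ y = y ⬝ᵥ M *ᵥ x := by
  have hT : Mᵀ = M := by simpa using hM.isHermitian.eq
  rw [dotProduct_mulVec, ← mulVec_transpose, hT, dotProduct_comm]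

theorem Matrix.PosDef.dotProduct_mulVec_self_nonneg (hM : M.PosDef) (x : n → ℝ) :
    0 ≤ x ⬝ᵥ M *ᵥ x := by
  simpa using hM.posSemidef.dotProduct_mulVec_nonneg x

theorem Matrix.PosDef.dotProduct_mulVec_self_eq_zero_iff (hM : M.PosDef) (x : n → ℝ) :
    x ⬝ᵥ M *ᵥ x = 0 ↔ x = 0 := by
  refine ⟨fun h => ?_, fun h => by simp [h]⟩
  by_contra hx
  simpa [h] using hM.dotProduct_mulVec_pos hx

theorem Matrix.PosDef.mulVec_inv_mulVec [DecidableEq n] (hM : M.PosDef) (x : n → ℝ) :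
    M *ᵥ (M⁻¹ *ᵥ x) = x := by
  rw [mulVec_mulVec, mul_nonsing_inv _ ((isUnit_iff_isUnit_det _).1 hM.isUnit), one_mulVec]

theorem Matrix.PosDef.inv_mulVec_mulVec [DecidableEq n] (hM : M.PosDef) (x : n → ℝ) :
    M⁻¹ *ᵥ (M *ᵥ x) = x := by
  rw [mulVec_mulVec, nonsing_inv_mul _ ((isUnit_iff_isUnit_det _).1 hM.isUnit), one_mulVec]

end PosDef

section RandomMatrix

variable {Ω : Type*} [MeasurableSpace Ω] {μ : Measure Ω}
  {n : Type*} [Fintype n] {M : Ω → Matrix n n ℝ}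

theorem quadratic_ae_nonneg (hM : ∀ᵐ ω ∂μ, (M ω).PosDef) (x : Ω → n → ℝ) :
    0 ≤ᵐ[μ] fun ω => x ω ⬝ᵥ M ω *ᵥ x ω := by
  filter_upwards [hM] with ω hω using hω.dotProduct_mulVec_self_nonneg _

/-- If `B'MB - B'w` and `w'M⁻¹w` are integrable then so is `MB`, without a moment condition
on `B`. -/
theorem integrable_dotProduct_mulVec [DecidableEq n] {w B : Ω → n → ℝ}
    (hM : ∀ᵐ ω ∂μ, (M ω).PosDef)
    (hIM : ∀ i j, Integrable (fun ω => M ω i j) μ) (hB : Measurable B)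
    (hIq : Integrable (fun ω => w ω ⬝ᵥ (M ω)⁻¹ *ᵥ w ω) μ)
    (hBMB : Integrable (fun ω => B ω ⬝ᵥ w ω - B ω ⬝ᵥ M ω *ᵥ B ω) μ) (c : n → ℝ) :
    Integrable (fun ω => c ⬝ᵥ M ω *ᵥ B ω) μ := by
  have hmeas : AEStronglyMeasurable (fun ω => c ⬝ᵥ M ω *ᵥ B ω) μ := by
    simp only [dotProduct, mulVec]
    refine Finset.aestronglyMeasurable_fun_sum _ fun i _ => ?_
    refine AEStronglyMeasurable.const_mul ?_ (c i)
    refine Finset.aestronglyMeasurable_fun_sum _ fun j _ => ?_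
    exact (hIM i j).1.mul ((measurable_pi_apply j).comp hB).aestronglyMeasurable
  refine Integrable.mono' ((((HasMean.dotProduct_mulVec hIM c c).1.const_mul (1 / 2)).sub
    hBMB).add (hIq.const_mul (1 / 2))) hmeas ?_
  filter_upwards [hM] with ω hω
  have hsymm := hω.dotProduct_mulVec_comm_real
  have h1 := hω.dotProduct_mulVec_self_nonneg (c + B ω)
  have h2 := hω.dotProduct_mulVec_self_nonneg (c - B ω)
  have h3 := hω.dotProduct_mulVec_self_nonneg (B ω - (M ω)⁻¹ *ᵥ w ω)
  simp only [mulVec_sub, mulVec_add, sub_dotProduct, dotProduct_sub, add_dotProduct,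
    dotProduct_add, hω.mulVec_inv_mulVec, hsymm (_ *ᵥ w ω) (B ω), hsymm (B ω) c,
    dotProduct_comm (_ *ᵥ w ω) (w ω)] at h1 h2 h3
  simp only [Real.norm_eq_abs, abs_le, Pi.add_apply, Pi.sub_apply]
  constructor <;> linarith

variable [IsProbabilityMeasure μ]

theorem EMat_posDef (hM : ∀ᵐ ω ∂μ, (M ω).PosDef)
    (hIM : ∀ i j, Integrable (fun ω => M ω i j) μ) : (EMat μ M).PosDef := by
  refine PosDef.of_dotProduct_mulVec_pos ?_ fun x hx => ?_
  · ext i j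
    refine integral_congr_ae ?_
    filter_upwards [hM] with ω hω
    simpa using hω.isHermitian.apply i j
  · have hmean := HasMean.dotProduct_mulVec hIM x x
    have hnn := quadratic_ae_nonneg hM fun _ => x
    refine lt_of_le_of_ne (by simpa using hmean.nonneg hnn) fun h => ?_
    obtain ⟨ω, h0, hω⟩ :=
      (((hmean.eq_zero_iff hnn).1 (by simpa using h.symm)).and hM).exists
    exact hx ((hω.dotProduct_mulVec_self_eq_zero_iff x).1 h0)

variable [DecidableEq n] {w : Ω → n → ℝ}

/-- Mean of the squared `M`-distance of `M⁻¹ w` from `E(M)⁻¹ E(w)`. -/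
theorem hasMean_inv_mulVec_sub_quadratic (hM : ∀ᵐ ω ∂μ, (M ω).PosDef)
    (hIM : ∀ i j, Integrable (fun ω => M ω i j) μ) (hIw : ∀ i, Integrable (fun ω => w ω i) μ)
    {a : ℝ} (hIq : HasMean μ (fun ω => w ω ⬝ᵥ (M ω)⁻¹ *ᵥ w ω) a) :
    HasMean μ (fun ω => ((M ω)⁻¹ *ᵥ w ω - (EMat μ M)⁻¹ *ᵥ EVec μ w) ⬝ᵥ
        M ω *ᵥ ((M ω)⁻¹ *ᵥ w ω - (EMat μ M)⁻¹ *ᵥ EVec μ w))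
      (a - EVec μ w ⬝ᵥ (EMat μ M)⁻¹ *ᵥ EVec μ w) := by
  have hS := EMat_posDef hM hIM
  set d := (EMat μ M)⁻¹ *ᵥ EVec μ w with hd
  have h := (hIq.sub ((HasMean.dotProduct hIw d).const_mul 2)).add
    (HasMean.dotProduct_mulVec hIM d d)
  rw [hd, hS.mulVec_inv_mulVec, ← hd, dotProduct_comm d] at h
  convert h.congr _ using 1
  · ring
  · filter_upwards [hM] with ω hω
    have h2 := hω.dotProduct_mulVec_comm_real ((M ω)⁻¹ *ᵥ w ω) d
    simp only [mulVec_sub, sub_dotProduct, dotProduct_sub, hω.mulVec_inv_mulVec] at h2 ⊢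
    rw [h2, dotProduct_comm (_ *ᵥ w ω) (w ω)]
    ring

theorem inv_mulVec_quadratic_gap_nonneg (hM : ∀ᵐ ω ∂μ, (M ω).PosDef)
    (hIM : ∀ i j, Integrable (fun ω => M ω i j) μ) (hIw : ∀ i, Integrable (fun ω => w ω i) μ)
    {a : ℝ} (hIq : HasMean μ (fun ω => w ω ⬝ᵥ (M ω)⁻¹ *ᵥ w ω) a) :
    0 ≤ a - EVec μ w ⬝ᵥ (EMat μ M)⁻¹ *ᵥ EVec μ w :=
  (hasMean_inv_mulVec_sub_quadratic hM hIM hIw hIq).nonneg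
    (quadratic_ae_nonneg hM _)

theorem inv_mulVec_quadratic_gap_eq_zero_iff (hM : ∀ᵐ ω ∂μ, (M ω).PosDef)
    (hIM : ∀ i j, Integrable (fun ω => M ω i j) μ) (hIw : ∀ i, Integrable (fun ω => w ω i) μ)
    {a : ℝ} (hIq : HasMean μ (fun ω => w ω ⬝ᵥ (M ω)⁻¹ *ᵥ w ω) a) :
    a - EVec μ w ⬝ᵥ (EMat μ M)⁻¹ *ᵥ EVec μ w = 0 ↔
      ∃ v : n → ℝ, ∀ᵐ ω ∂μ, (M ω)⁻¹ *ᵥ w ω = v := by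
  rw [(hasMean_inv_mulVec_sub_quadratic hM hIM hIw hIq).eq_zero_iff
    (quadratic_ae_nonneg hM _)]
  constructor
  · intro h
    refine ⟨(EMat μ M)⁻¹ *ᵥ EVec μ w, ?_⟩
    filter_upwards [h, hM] with ω h0 hω
    exact sub_eq_zero.1 ((hω.dotProduct_mulVec_self_eq_zero_iff _).1 h0)
  · rintro ⟨v, hv⟩
    have hEw : EVec μ w = EMat μ M *ᵥ v := by
      refine dotProduct_eq _ _ fun c => ?_
      rw [dotProduct_comm, dotProduct_comm _ c, ← (HasMean.dotProduct hIw c).2,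
        ← (HasMean.dotProduct_mulVec hIM c v).2]
      refine integral_congr_ae ?_
      filter_upwards [hv, hM] with ω hvω hω
      rw [← hvω, hω.mulVec_inv_mulVec]
    rw [hEw, (EMat_posDef hM hIM).inv_mulVec_mulVec]
    filter_upwards [hv] with ω hω
    simp [hω]

/-- Cauchy–Schwarz bound for the mean of `e'B`, given the moment conditions `E(MB) = E(w)` and
`E(B'MB) = E(B'w)`. -/
theorem sq_integral_sub_le {B : Ω → n → ℝ} {e : n → ℝ} (hM : ∀ᵐ ω ∂μ, (M ω).PosDef)
    (hIM : ∀ i j, Integrable (fun ω => M ω i j) μ)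
    (hIMinv : ∀ i j, Integrable (fun ω => (M ω)⁻¹ i j) μ)
    (hIw : ∀ i, Integrable (fun ω => w ω i) μ)
    (hIm : ∀ i, Integrable (fun ω => ((M ω)⁻¹ *ᵥ w ω) i) μ)
    {a b : ℝ} (hIq : HasMean μ (fun ω => w ω ⬝ᵥ (M ω)⁻¹ *ᵥ w ω) a)
    (hIeB : HasMean μ (fun ω => e ⬝ᵥ B ω) b)
    (hMB : ∀ c, HasMean μ (fun ω => c ⬝ᵥ M ω *ᵥ B ω) (c ⬝ᵥ EVec μ w))
    (hBMB : HasMean μ (fun ω => B ω ⬝ᵥ w ω - B ω ⬝ᵥ M ω *ᵥ B ω) 0) :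
    (2 * (b - ((1 / 2) * (e ⬝ᵥ EVec μ (fun ω => (M ω)⁻¹ *ᵥ w ω))
        + (1 / 2) * (e ⬝ᵥ (EMat μ M)⁻¹ *ᵥ EVec μ w)))) ^ 2 ≤
      (e ⬝ᵥ EMat μ (fun ω => (M ω)⁻¹) *ᵥ e - e ⬝ᵥ (EMat μ M)⁻¹ *ᵥ e) *
        (a - EVec μ w ⬝ᵥ (EMat μ M)⁻¹ *ᵥ EVec μ w) := by
  have hS := EMat_posDef hM hIM
  set c := (EMat μ M)⁻¹ *ᵥ e with hc
  set d := (EMat μ M)⁻¹ *ᵥ EVec μ w with hd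
  have hSc : EMat μ M *ᵥ c = e := by rw [hc, hS.mulVec_inv_mulVec]
  have hSd : EMat μ M *ᵥ d = EVec μ w := by rw [hd, hS.mulVec_inv_mulVec]
  have hcw : c ⬝ᵥ EVec μ w = e ⬝ᵥ d := by
    rw [← hSd, hS.dotProduct_mulVec_comm_real, hSc, dotProduct_comm]
  have hU := ((HasMean.dotProduct_mulVec hIMinv e e).sub
    ((HasMean.const (2 * (e ⬝ᵥ c))))).add (HasMean.dotProduct_mulVec hIM c c)
  have hV := ((((hIeB.sub ((HasMean.dotProduct hIm e).const_mul (1 / 2))).sub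
    (HasMean.const ((1 / 2) * (e ⬝ᵥ d)))).sub (hMB c)).add
    ((HasMean.dotProduct hIw c).const_mul (1 / 2))).add
    ((HasMean.dotProduct_mulVec hIM c d).const_mul (1 / 2))
  have hW := (((((hIq.const_mul (1 / 4)).sub hBMB).sub (hMB d)).add
    ((HasMean.dotProduct hIw d).const_mul (1 / 2))).add
    ((HasMean.dotProduct_mulVec hIM d d).const_mul (1 / 4)))
  rw [hSc, dotProduct_comm c e] at hU
  rw [hSd, hcw] at hV
  rw [hSd, dotProduct_comm d] at hW
  have hdisc := discrim_le_zero
    (a := e ⬝ᵥ EMat μ (fun ω => (M ω)⁻¹) *ᵥ e - e ⬝ᵥ c)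
    (b := 2 * (b - ((1 / 2) * (e ⬝ᵥ EVec μ (fun ω => (M ω)⁻¹ *ᵥ w ω))
        + (1 / 2) * (e ⬝ᵥ d))))
    (c := (1 / 4) * (a - EVec μ w ⬝ᵥ d)) fun s => by
      have hQ := (((hU.const_mul (s * s)).add (hV.const_mul (2 * s))).add hW).nonneg ?_
      · refine hQ.trans_eq ?_
        ring
      · filter_upwards [hM] with ω hω
        refine (hω.dotProduct_mulVec_self_nonneg (s • ((M ω)⁻¹ *ᵥ e - c) +
          (B ω - (1 / 2 : ℝ) • ((M ω)⁻¹ *ᵥ w ω) - (1 / 2 : ℝ) • d))).trans_eq ?_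
        have hsymm := hω.dotProduct_mulVec_comm_real
        have he : ∀ x, ((M ω)⁻¹ *ᵥ e) ⬝ᵥ M ω *ᵥ x = e ⬝ᵥ x := fun x => by
          rw [hsymm, hω.mulVec_inv_mulVec, dotProduct_comm]
        have hw : ∀ x, ((M ω)⁻¹ *ᵥ w ω) ⬝ᵥ M ω *ᵥ x = x ⬝ᵥ w ω := fun x => by
          rw [hsymm, hω.mulVec_inv_mulVec]
        simp only [mulVec_sub, mulVec_add, mulVec_smul, sub_dotProduct, dotProduct_sub,
          add_dotProduct, dotProduct_add, smul_dotProduct, dotProduct_smul, smul_eq_mul, he, hw,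
          hω.mulVec_inv_mulVec]
        rw [hsymm d c, hsymm (B ω) c, hsymm (B ω) d, dotProduct_comm c e,
          dotProduct_comm (_ *ᵥ w ω) (w ω), dotProduct_comm (B ω) e,
          dotProduct_comm (_ *ᵥ w ω) e, dotProduct_comm d e, dotProduct_comm (_ *ᵥ e) e]
        have hew := he ((M ω)⁻¹ *ᵥ w ω)
        rw [hω.mulVec_inv_mulVec] at hew
        rw [hew]
        ring
  rw [discrim] at hdisc
  linarith

end RandomMatrix

/-- **Closed-form bounds for the mean of random coefficients (Theorem 1).**
In the linear panel model `Y_t = R_t'B + ε_t` with sequential exogeneity (Assumption 1)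
and a.s. positive definite `R'R` (Assumption 2), with all relevant expectations finite,
the mean `E(e'B)` lies in `[𝓑_R − √(𝓔_R 𝓓_R)/2, 𝓑_R + √(𝓔_R 𝓓_R)/2]`; moreover
`𝓔_R, 𝓓_R ≥ 0`, with `𝓔_R = 0` iff `(R'R)⁻¹e` is a.s. constant and `𝓓_R = 0` iff
`(R'R)⁻¹R'Y` is a.s. constant. -/
theorem mean_closed_form_bounds
    {T q p : ℕ} (hT : 1 ≤ T) (hqp : 1 ≤ q + p)
    {Ω : Type*} [MeasurableSpace Ω] (μ : Measure Ω) [IsProbabilityMeasure μ]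
    (Z : Fin T → Ω → Fin q → ℝ) (X : Fin T → Ω → Fin p → ℝ)
    (Y : Ω → Fin T → ℝ) (B : Ω → Fin (q + p) → ℝ)
    (hZ : ∀ t, Measurable (Z t)) (hX : ∀ t, Measurable (X t))
    (hY : Measurable Y) (hB : Measurable B)
    (R : Ω → Matrix (Fin T) (Fin (q + p)) ℝ)
    (hR : ∀ ω t, R ω t = Fin.append (Z t ω) (X t ω))
    -- Assumption 1 (sequential exogeneity)
    (hεint : ∀ t : Fin T, Integrable (fun ω => Y ω t - R ω t ⬝ᵥ B ω) μ)
    (hA1 : ∀ t : Fin T,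
      μ[(fun ω => Y ω t - R ω t ⬝ᵥ B ω)|
        MeasurableSpace.comap
          (fun ω => (B ω, fun u : Fin T => Z u ω, fun u : {u : Fin T // u ≤ t} => X u.1 ω))
          inferInstance] =ᵐ[μ] 0)
    -- Assumption 2 (no multicollinearity)
    (hA2 : ∀ᵐ ω ∂μ, ((R ω)ᵀ * R ω).PosDef)
    (e : Fin (q + p) → ℝ)
    -- all relevant expectations exist and are finite
    (hIeB : Integrable (fun ω => e ⬝ᵥ B ω) μ)
    (hIRR : ∀ i j, Integrable (fun ω => ((R ω)ᵀ * R ω) i j) μ)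
    (hIRRinv : ∀ i j, Integrable (fun ω => (((R ω)ᵀ * R ω)⁻¹) i j) μ)
    (hIRY : ∀ i, Integrable (fun ω => ((R ω)ᵀ *ᵥ Y ω) i) μ)
    (hIBhat : ∀ i, Integrable (fun ω => (((R ω)ᵀ * R ω)⁻¹ *ᵥ ((R ω)ᵀ *ᵥ Y ω)) i) μ)
    (hIYPY : Integrable
      (fun ω => Y ω ⬝ᵥ (R ω *ᵥ (((R ω)ᵀ * R ω)⁻¹ *ᵥ ((R ω)ᵀ *ᵥ Y ω)))) μ)
    (hIRBε : ∀ t : Fin T,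
      Integrable (fun ω => (R ω t ⬝ᵥ B ω) * (Y ω t - R ω t ⬝ᵥ B ω)) μ) :
    ∀ BR ER DR : ℝ,
      BR = (1 / 2) * (e ⬝ᵥ EVec μ (fun ω => ((R ω)ᵀ * R ω)⁻¹ *ᵥ ((R ω)ᵀ *ᵥ Y ω)))
          + (1 / 2) * (e ⬝ᵥ ((EMat μ (fun ω => (R ω)ᵀ * R ω))⁻¹ *ᵥ
              EVec μ (fun ω => (R ω)ᵀ *ᵥ Y ω))) →
      ER = e ⬝ᵥ (EMat μ (fun ω => ((R ω)ᵀ * R ω)⁻¹) *ᵥ e)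
          - e ⬝ᵥ ((EMat μ (fun ω => (R ω)ᵀ * R ω))⁻¹ *ᵥ e) →
      DR = (∫ ω, Y ω ⬝ᵥ (R ω *ᵥ (((R ω)ᵀ * R ω)⁻¹ *ᵥ ((R ω)ᵀ *ᵥ Y ω))) ∂μ)
          - (EVec μ (fun ω => (R ω)ᵀ *ᵥ Y ω)) ⬝ᵥ
              ((EMat μ (fun ω => (R ω)ᵀ * R ω))⁻¹ *ᵥ EVec μ (fun ω => (R ω)ᵀ *ᵥ Y ω)) →
      (BR - Real.sqrt (ER * DR) / 2 ≤ ∫ ω, e ⬝ᵥ B ω ∂μ ∧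
        ∫ ω, e ⬝ᵥ B ω ∂μ ≤ BR + Real.sqrt (ER * DR) / 2) ∧
      (0 ≤ ER ∧ 0 ≤ DR) ∧
      (ER = 0 ↔ ∃ v : Fin (q + p) → ℝ, ∀ᵐ ω ∂μ, ((R ω)ᵀ * R ω)⁻¹ *ᵥ e = v) ∧
      (DR = 0 ↔ ∃ v : Fin (q + p) → ℝ,
        ∀ᵐ ω ∂μ, ((R ω)ᵀ * R ω)⁻¹ *ᵥ ((R ω)ᵀ *ᵥ Y ω) = v) := by
  set M : Ω → Matrix (Fin (q + p)) (Fin (q + p)) ℝ := fun ω => (R ω)ᵀ * R ω with hMdef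
  set w : Ω → Fin (q + p) → ℝ := fun ω => (R ω)ᵀ *ᵥ Y ω with hwdef
  set G : ∀ t : Fin T, Ω → (Fin (q + p) → ℝ) × (Fin T → Fin q → ℝ) ×
      ({u : Fin T // u ≤ t} → Fin p → ℝ) := fun t ω =>
    (B ω, fun u : Fin T => Z u ω, fun u : {u : Fin T // u ≤ t} => X u.1 ω) with hG
  have hGmeas : ∀ t, Measurable (G t) := fun t => by fun_prop
  have hle : ∀ t, MeasurableSpace.comap (G t) inferInstance ≤ ‹MeasurableSpace Ω› :=
    fun t => (hGmeas t).comap_le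
  have hmono : Monotone fun t => MeasurableSpace.comap (G t) inferInstance := by
    intro t s hts
    let φ : (Fin (q + p) → ℝ) × (Fin T → Fin q → ℝ) × ({u : Fin T // u ≤ s} → Fin p → ℝ) →
        (Fin (q + p) → ℝ) × (Fin T → Fin q → ℝ) × ({u : Fin T // u ≤ t} → Fin p → ℝ) :=
      fun x => (x.1, x.2.1, fun u => x.2.2 ⟨u.1, u.2.trans hts⟩)
    have hφ : Measurable φ := by fun_prop
    exact (hφ.comp (comap_measurable (G s))).comap_le
  have hBmeas : ∀ t, Measurable[MeasurableSpace.comap (G t) inferInstance] B := fun t =>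
    measurable_fst.comp (comap_measurable (G t))
  have hRmeas : ∀ t j, Measurable[MeasurableSpace.comap (G t) inferInstance]
      fun ω => R ω t j := fun t j => by
    have hZt : Measurable[MeasurableSpace.comap (G t) inferInstance] (Z t) :=
      (show Measurable fun x : (Fin (q + p) → ℝ) × (Fin T → Fin q → ℝ) ×
        ({u : Fin T // u ≤ t} → Fin p → ℝ) => x.2.1 t by fun_prop).comp (comap_measurable (G t))
    have hXt : Measurable[MeasurableSpace.comap (G t) inferInstance] (X t) :=
      (show Measurable fun x : (Fin (q + p) → ℝ) × (Fin T → Fin q → ℝ) ×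
        ({u : Fin T // u ≤ t} → Fin p → ℝ) => x.2.2 ⟨t, le_rfl⟩ by fun_prop).comp
        (comap_measurable (G t))
    refine Fin.addCases (fun i => ?_) (fun i => ?_) j
    · simpa only [hR, Fin.append_left, Function.comp_def] using (measurable_pi_apply i).comp hZt
    · simpa only [hR, Fin.append_right, Function.comp_def] using (measurable_pi_apply i).comp hXt
  have hRdot : ∀ t (x : Ω → Fin (q + p) → ℝ),
      Measurable[MeasurableSpace.comap (G t) inferInstance] x →
      StronglyMeasurable[MeasurableSpace.comap (G t) inferInstance] fun ω => R ω t ⬝ᵥ x ω :=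
    fun t x hx => (Finset.measurable_fun_sum _ fun j _ =>
      (hRmeas t j).mul ((measurable_pi_apply j).comp hx)).stronglyMeasurable
  have hexp : ∀ (x : Fin (q + p) → ℝ) ω, x ⬝ᵥ w ω - x ⬝ᵥ M ω *ᵥ B ω =
      ∑ t, (R ω t ⬝ᵥ x) * (Y ω t - R ω t ⬝ᵥ B ω) := fun x ω => by
    rw [hMdef, hwdef, ← mulVec_mulVec, ← dotProduct_sub, ← mulVec_sub, dotProduct_mulVec,
      vecMul_transpose]
    rfl
  have hYq : ∀ ω, Y ω ⬝ᵥ R ω *ᵥ ((M ω)⁻¹ *ᵥ w ω) = w ω ⬝ᵥ (M ω)⁻¹ *ᵥ w ω := fun ω => by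
    rw [dotProduct_mulVec, ← mulVec_transpose]
  have hBMB : HasMean μ (fun ω => B ω ⬝ᵥ w ω - B ω ⬝ᵥ M ω *ᵥ B ω) 0 := by
    simp only [hexp]
    have hI : Integrable
        (fun ω => ∑ t, (R ω t ⬝ᵥ B ω) * (Y ω t - R ω t ⬝ᵥ B ω)) μ :=
      integrable_finsetSum _ fun t _ => hIRBε t
    exact ⟨hI, integral_sum_mul_eq_zero_of_condExp_eq_zero hmono hle
      (fun t => hRdot t B (hBmeas t)) hεint hA1 hI⟩
  intro BR ER DR hBR hER hDR
  have hIq : HasMean μ (fun ω => w ω ⬝ᵥ (M ω)⁻¹ *ᵥ w ω)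
      (∫ ω, Y ω ⬝ᵥ (R ω *ᵥ ((M ω)⁻¹ *ᵥ w ω)) ∂μ) :=
    HasMean.congr ⟨hIYPY, rfl⟩ (.of_forall hYq)
  have hMB : ∀ c, HasMean μ (fun ω => c ⬝ᵥ M ω *ᵥ B ω) (c ⬝ᵥ EVec μ w) := fun c => by
    have hint := integrable_dotProduct_mulVec hA2 hIRR hB hIq.1 hBMB.1 c
    have hcw := HasMean.dotProduct hIRY c
    have hI := (hcw.1.sub hint).congr (.of_forall (hexp c))
    have h0 := integral_sum_mul_eq_zero_of_condExp_eq_zero hmono hle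
      (fun t => hRdot t (fun _ => c) measurable_const) hεint hA1 hI
    simp only [← hexp] at h0
    rw [integral_sub hcw.1 hint, hcw.2] at h0
    exact ⟨hint, by linarith⟩
  have hIe : ∀ i, Integrable (fun _ : Ω => e i) μ := fun i => integrable_const _
  have hEe : EVec μ (fun _ : Ω => e) = e := by
    ext i
    simp [EVec]
  have hIeq := HasMean.dotProduct_mulVec hIRRinv e e
  have hE := inv_mulVec_quadratic_gap_nonneg hA2 hIRR hIe hIeq
  have hE0 := inv_mulVec_quadratic_gap_eq_zero_iff hA2 hIRR hIe hIeq
  have hD := inv_mulVec_quadratic_gap_nonneg hA2 hIRR hIRY hIq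
  have hD0 := inv_mulVec_quadratic_gap_eq_zero_iff hA2 hIRR hIRY hIq
  have hCS := sq_integral_sub_le hA2 hIRR hIRRinv hIRY hIBhat hIq ⟨hIeB, rfl⟩ hMB hBMB
  rw [hEe, ← hER] at hE hE0
  rw [← hDR] at hD hD0
  rw [← hBR, ← hER, ← hDR] at hCS
  obtain ⟨hlo, hhi⟩ := abs_le.1 (Real.abs_le_sqrt hCS)
  exact ⟨⟨by linarith, by linarith⟩, ⟨hE, hD⟩, hE0, hD0⟩
end
end

section
/- Let l, n, m be positive integers, let A₁,…,A_l be real n × m matrices, let B₁,…,B_l be symmetric positive definite real n × n matrices, and let a₁,…,a_l be positive real numbers with a₁ + … + a_l = 1. Then the m × m matrix ∑_{k=1}^l a_k A_k' B_k⁻¹ A_k − (∑_{k=1}^l a_k A_k)' (∑_{k=1}^l a_k B_k)⁻¹ (∑_{k=1}^l a_k A_k) is positive semidefinite, and it equals the zero matrix if and only if B₁⁻¹A₁ = B₂⁻¹A₂ = … = B_l⁻¹A_l. -/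
open Matrix

namespace Matrix

variable {ι n m : Type*} [Fintype ι] [Fintype n]

/-- Congruence by `D` of a positive definite matrix vanishes only if `D` does. -/
theorem PosDef.eq_zero_of_transpose_mul_mul_same_eq_zero [Fintype m]
    {B : Matrix n n ℝ} (hB : B.PosDef) {D : Matrix n m ℝ} (h : Dᵀ * B * D = 0) : D = 0 := by
  classical
  refine Matrix.ext_of_mulVec_single fun i => ?_
  rw [zero_mulVec]
  by_contra hx
  have hpos := hB.dotProduct_mulVec_pos hx
  have hz : (D *ᵥ Pi.single i 1) ⬝ᵥ (B *ᵥ (D *ᵥ Pi.single i 1)) = 0 := by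
    rw [dotProduct_comm, dotProduct_mulVec, ← mulVec_transpose, mulVec_mulVec, mulVec_mulVec,
      h, zero_mulVec, zero_dotProduct]
  rw [star_trivial, hz] at hpos
  exact hpos.false

/-- If a sum of positive semidefinite real matrices is zero, so is every summand. -/
theorem PosSemidef.eq_zero_of_sum_eq_zero [Fintype m] {M : ι → Matrix m m ℝ}
    (hM : ∀ k, (M k).PosSemidef) (h : ∑ k, M k = 0) (k : ι) : M k = 0 := by
  have htr : ∑ k, (M k).trace = 0 := by rw [← trace_sum, h, trace_zero]
  rw [Finset.sum_eq_zero_iff_of_nonneg fun k _ => (hM k).trace_nonneg] at htr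
  exact (hM k).trace_eq_zero_iff.mp (htr k (Finset.mem_univ k))

/-- Kiefer's difference as a weighted sum of congruences. -/
theorem sum_smul_transpose_mul_inv_mul_sub [DecidableEq n] (A : ι → Matrix n m ℝ)
    (B : ι → Matrix n n ℝ) (hB : ∀ k, (B k).PosDef) (a : ι → ℝ)
    (hS : (∑ k, a k • B k).PosDef) :
    ∑ k, a k • ((A k)ᵀ * (B k)⁻¹ * A k) -
        (∑ k, a k • A k)ᵀ * (∑ k, a k • B k)⁻¹ * (∑ k, a k • A k) =
      ∑ k, a k • (((B k)⁻¹ * A k - (∑ k, a k • B k)⁻¹ * ∑ k, a k • A k)ᵀ * B k *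
        ((B k)⁻¹ * A k - (∑ k, a k • B k)⁻¹ * ∑ k, a k • A k)) := by
  set S := ∑ k, a k • B k with hSdef
  set T := ∑ k, a k • A k with hTdef
  set C := S⁻¹ * T with hC
  have hSC : S * C = T := mul_nonsing_inv_cancel_left _ _ ((isUnit_iff_isUnit_det _).mp hS.isUnit)
  have hterm (k : ι) : ((B k)⁻¹ * A k - C)ᵀ * B k * ((B k)⁻¹ * A k - C) =
      (A k)ᵀ * (B k)⁻¹ * A k - (A k)ᵀ * C - Cᵀ * A k + Cᵀ * B k * C := by
    have hdet := (isUnit_iff_isUnit_det _).mp (hB k).isUnit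
    have hsymm : ((B k)⁻¹)ᵀ = (B k)⁻¹ := by
      simpa only [IsHermitian, conjTranspose_eq_transpose_of_trivial] using (hB k).inv.isHermitian
    have hleft : ((B k)⁻¹ * A k - C)ᵀ * B k = (A k)ᵀ - Cᵀ * B k := by
      rw [transpose_sub, transpose_mul, hsymm, Matrix.sub_mul,
        nonsing_inv_mul_cancel_right _ _ hdet]
    have hcancel : Cᵀ * B k * ((B k)⁻¹ * A k) = Cᵀ * A k := by
      rw [Matrix.mul_assoc, mul_nonsing_inv_cancel_left _ _ hdet]
    rw [hleft, Matrix.sub_mul, Matrix.mul_sub, Matrix.mul_sub, hcancel, ← Matrix.mul_assoc]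
    abel
  have hAC : ∑ k, a k • ((A k)ᵀ * C) = Tᵀ * C := by
    simp only [hTdef, transpose_sum, transpose_smul, Matrix.sum_mul, Matrix.smul_mul]
  have hCA : ∑ k, a k • (Cᵀ * A k) = Cᵀ * T := by
    simp only [hTdef, Matrix.mul_sum, Matrix.mul_smul]
  have hCBC : ∑ k, a k • (Cᵀ * B k * C) = Cᵀ * T := by
    rw [← hSC, ← Matrix.mul_assoc]
    simp only [hSdef, Matrix.mul_sum, Matrix.sum_mul, Matrix.mul_smul, Matrix.smul_mul]
  simp only [hterm, smul_add, smul_sub, Finset.sum_add_distrib, Finset.sum_sub_distrib, hAC, hCA,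
    hCBC]
  rw [sub_add_cancel, Matrix.mul_assoc]

end Matrix

/-- **Kiefer's lemma.** For matrices `A k` and symmetric positive definite matrices `B k`
and positive weights `a k` summing to one, the matrix
`∑ k, a k • (A k)ᵀ (B k)⁻¹ (A k) − (∑ k, a k • A k)ᵀ (∑ k, a k • B k)⁻¹ (∑ k, a k • A k)`
is positive semidefinite, and it vanishes iff `(B k)⁻¹ * A k` is constant in `k`. -/
theorem kiefer_matrix_inequality {l n m : ℕ} (hl : 0 < l) (hn : 0 < n) (hm : 0 < m)
    (A : Fin l → Matrix (Fin n) (Fin m) ℝ)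
    (B : Fin l → Matrix (Fin n) (Fin n) ℝ)
    (hB : ∀ k, (B k).PosDef)
    (a : Fin l → ℝ) (ha : ∀ k, 0 < a k) (hsum : ∑ k, a k = 1) :
    (∑ k, a k • ((A k)ᵀ * (B k)⁻¹ * A k) -
        (∑ k, a k • A k)ᵀ * (∑ k, a k • B k)⁻¹ * (∑ k, a k • A k)).PosSemidef ∧
      ((∑ k, a k • ((A k)ᵀ * (B k)⁻¹ * A k) -
        (∑ k, a k • A k)ᵀ * (∑ k, a k • B k)⁻¹ * (∑ k, a k • A k)) = 0 ↔
        ∀ j k : Fin l, (B j)⁻¹ * A j = (B k)⁻¹ * A k) := by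
  have : Nonempty (Fin l) := ⟨⟨0, hl⟩⟩
  have hS : (∑ k, a k • B k).PosDef :=
    posDef_sum Finset.univ_nonempty fun k _ => (hB k).smul (ha k)
  rw [sum_smul_transpose_mul_inv_mul_sub A B hB a hS]
  have hpsd (D : Matrix (Fin n) (Fin m) ℝ) (k : Fin l) : (a k • (Dᵀ * B k * D)).PosSemidef := by
    rw [← conjTranspose_eq_transpose_of_trivial]
    exact ((hB k).posSemidef.conjTranspose_mul_mul_same D).smul (ha k).le
  refine ⟨posSemidef_sum _ fun k _ => hpsd _ k, fun h j k => ?_, fun h => ?_⟩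
  · have hconst (i : Fin l) := sub_eq_zero.mp <|
      (hB i).eq_zero_of_transpose_mul_mul_same_eq_zero <|
        (smul_eq_zero_iff_right (ha i).ne').mp <|
          PosSemidef.eq_zero_of_sum_eq_zero (fun k => hpsd _ k) h i
    rw [hconst j, hconst k]
  · have hA (j k : Fin l) : A k = B k * ((B j)⁻¹ * A j) := by
      rw [h j k, mul_nonsing_inv_cancel_left _ _ ((isUnit_iff_isUnit_det _).mp (hB k).isUnit)]
    have hT (j : Fin l) : ∑ k, a k • A k = (∑ k, a k • B k) * ((B j)⁻¹ * A j) := by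
      rw [Matrix.sum_mul]
      exact Finset.sum_congr rfl fun k _ => by rw [Matrix.smul_mul, ← hA j k]
    refine Finset.sum_eq_zero fun k _ => ?_
    rw [hT k, nonsing_inv_mul_cancel_left _ _ ((isUnit_iff_isUnit_det _).mp hS.isUnit), sub_self,
      Matrix.mul_zero, smul_zero]
end

section
/- Under the linear panel data model with heterogeneous (random) coefficients and the instrument setup, suppose Assumptions 1, 2 and 3 hold, fix e ∈ ℝ^r, and assume all expectations appearing below exist and are finite. Define 𝒱_S = E(SR(R'R)⁻¹R'S'), 𝒴_S = E(SR(R'R)⁻¹R'Y), 𝒫_S = E(SR(R'R)⁻¹), Y_S = E(SY), m₀ = E(Y'R(R'R)⁻¹R'Y), and B̂ = (R'R)⁻¹R'Y. Then 𝒱_S is positive definite (in particular invertible), and 𝓑_S − ½√(𝓔_S 𝓓_S) ≤ E(e'B) ≤ 𝓑_S + ½√(𝓔_S 𝓓_S), where 𝓑_S = ½ e'E(B̂) + ½ e'𝒫_S'𝒱_S⁻¹(2Y_S − 𝒴_S), 𝓔_S = e'E((R'R)⁻¹)e − e'𝒫_S'𝒱_S⁻¹𝒫_S e, and 𝓓_S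 = m₀ − (2Y_S − 𝒴_S)'𝒱_S⁻¹(2Y_S − 𝒴_S). -/
open MeasureTheory Matrix

noncomputable section

section Expectation

variable {Ω : Type*} [MeasurableSpace Ω] {μ : Measure Ω} {m n : Type*} [Fintype n]

theorem integrable_dotProduct_const (x : n → ℝ) {v : Ω → n → ℝ}
    (hv : ∀ i, Integrable (fun ω => v ω i) μ) : Integrable (fun ω => x ⬝ᵥ v ω) μ :=
  integrable_finsetSum _ fun i _ => (hv i).const_mul (x i)

theorem integral_dotProduct_const (x : n → ℝ) {v : Ω → n → ℝ}
    (hv : ∀ i, Integrable (fun ω => v ω i) μ) :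
    ∫ ω, x ⬝ᵥ v ω ∂μ = x ⬝ᵥ EVec μ v := by
  simp only [dotProduct, EVec]
  rw [integral_finsetSum _ fun i _ => (hv i).const_mul (x i)]
  simp only [integral_const_mul]

theorem integrable_mulVec_const (y : n → ℝ) {F : Ω → Matrix m n ℝ}
    (hF : ∀ i j, Integrable (fun ω => F ω i j) μ) (i : m) :
    Integrable (fun ω => (F ω *ᵥ y) i) μ :=
  integrable_finsetSum _ fun j _ => (hF i j).mul_const (y j)

theorem EVec_mulVec_const (y : n → ℝ) {F : Ω → Matrix m n ℝ}
    (hF : ∀ i j, Integrable (fun ω => F ω i j) μ) :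
    EVec μ (fun ω => F ω *ᵥ y) = EMat μ F *ᵥ y := by
  ext i
  simp only [mulVec, dotProduct, EVec, EMat, of_apply]
  rw [integral_finsetSum _ fun j _ => (hF i j).mul_const (y j)]
  simp only [integral_mul_const]

theorem integrable_dotProduct_mulVec_const [Fintype m] (x : m → ℝ) (y : n → ℝ)
    {F : Ω → Matrix m n ℝ}
    (hF : ∀ i j, Integrable (fun ω => F ω i j) μ) :
    Integrable (fun ω => x ⬝ᵥ (F ω *ᵥ y)) μ :=
  integrable_dotProduct_const x (integrable_mulVec_const y hF)

theorem integral_dotProduct_mulVec_const [Fintype m] (x : m → ℝ) (y : n → ℝ)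
    {F : Ω → Matrix m n ℝ}
    (hF : ∀ i j, Integrable (fun ω => F ω i j) μ) :
    ∫ ω, x ⬝ᵥ (F ω *ᵥ y) ∂μ = x ⬝ᵥ (EMat μ F *ᵥ y) := by
  rw [integral_dotProduct_const x (integrable_mulVec_const y hF), EVec_mulVec_const y hF]

/-- Linearity of the integral for the quadratic form in two scalars expanded in
`dotProduct_self_projection_expansion`. -/
theorem integral_quadratic_combination {Ω : Type*} [MeasurableSpace Ω] {μ : Measure Ω}
    {f₁ f₂ f₃ f₄ f₅ f₆ f₇ f₈ f₉ f₁₀ : Ω → ℝ} (h₁ : Integrable f₁ μ) (h₂ : Integrable f₂ μ)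
    (h₃ : Integrable f₃ μ) (h₄ : Integrable f₄ μ) (h₅ : Integrable f₅ μ) (h₆ : Integrable f₆ μ)
    (h₇ : Integrable f₇ μ) (h₈ : Integrable f₈ μ) (h₉ : Integrable f₉ μ)
    (h₁₀ : Integrable f₁₀ μ) (x y : ℝ) :
    ∫ ω, (x ^ 2 * f₁ ω + f₂ ω + y ^ 2 * (f₃ ω - 4 * f₄ ω) + 2 * x * f₅ ω
        + 2 * y * (2 * f₆ ω - 2 * f₇ ω - f₈ ω) + 2 * x * y * (2 * f₉ ω - f₁₀ ω)) ∂μ =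
      x ^ 2 * ∫ ω, f₁ ω ∂μ + ∫ ω, f₂ ω ∂μ + y ^ 2 * (∫ ω, f₃ ω ∂μ - 4 * ∫ ω, f₄ ω ∂μ)
        + 2 * x * ∫ ω, f₅ ω ∂μ
        + 2 * y * (2 * ∫ ω, f₆ ω ∂μ - 2 * ∫ ω, f₇ ω ∂μ - ∫ ω, f₈ ω ∂μ)
        + 2 * x * y * (2 * ∫ ω, f₉ ω ∂μ - ∫ ω, f₁₀ ω ∂μ) := by
  simp (disch := fun_prop) only [integral_add, integral_sub, integral_const_mul]

end Expectation

theorem integral_mul_eq_zero_of_condExp_eq_zero {Ω : Type*}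
    {m' m₀ : MeasurableSpace Ω} {μ : Measure Ω} [IsFiniteMeasure μ] (hm : m' ≤ m₀)
    {f g : Ω → ℝ} (hf : StronglyMeasurable[m'] f)
    (hfg : Integrable (fun ω => f ω * g ω) μ) (hg : Integrable g μ) (h0 : μ[g|m'] =ᵐ[μ] 0) :
    ∫ ω, f ω * g ω ∂μ = 0 := by
  have h := condExp_mul_of_stronglyMeasurable_left hf (show Integrable (f * g) μ from hfg) hg
  calc ∫ ω, f ω * g ω ∂μ = ∫ ω, (μ[f * g|m']) ω ∂μ := (integral_condExp (f := f * g) hm).symm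
    _ = ∫ _, (0 : ℝ) ∂μ := integral_congr_ae (by
        filter_upwards [h, h0] with ω h1 h2
        rw [h1, Pi.mul_apply, h2, Pi.zero_apply, mul_zero])
    _ = 0 := integral_zero _ _

section LinearAlgebra

variable {ι m n : Type*} [Fintype ι] [Fintype m] [Fintype n]

theorem dotProduct_mulVec_comm_of_transpose_eq {A : Matrix n n ℝ} (hA : Aᵀ = A) (v w : n → ℝ) :
    v ⬝ᵥ (A *ᵥ w) = w ⬝ᵥ (A *ᵥ v) := by
  conv_lhs => rw [← hA]
  rw [dotProduct_mulVec, vecMul_transpose, dotProduct_comm]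

theorem dotProduct_mul_mul_transpose_mulVec (A : Matrix ι n ℝ) (M : Matrix n n ℝ) (a : ι → ℝ) :
    a ⬝ᵥ ((A * M * Aᵀ) *ᵥ a) = (Aᵀ *ᵥ a) ⬝ᵥ (M *ᵥ (Aᵀ *ᵥ a)) := by
  rw [← mulVec_mulVec, ← mulVec_mulVec, dotProduct_mulVec a A, mulVec_transpose]

/-- Expansion of the squared norm of `R (x M e + M Rᵀ Sᵀ a + y (2 B - M Rᵀ Y))`,
where `M` is the inverse of the Gram matrix `Rᵀ R`. -/
theorem dotProduct_self_projection_expansion [DecidableEq n] (S : Matrix ι m ℝ) (R : Matrix m n ℝ)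
    (hR : IsUnit (Rᵀ * R).det) (Y : m → ℝ) (B e : n → ℝ) (a : ι → ℝ) (x y : ℝ) :
    let M := (Rᵀ * R)⁻¹
    let c := x • (M *ᵥ e) + M *ᵥ (Rᵀ *ᵥ (Sᵀ *ᵥ a)) + y • ((2 : ℝ) • B - M *ᵥ (Rᵀ *ᵥ Y))
    (R *ᵥ c) ⬝ᵥ (R *ᵥ c) =
      x ^ 2 * (e ⬝ᵥ (M *ᵥ e)) + a ⬝ᵥ ((S * R * M * Rᵀ * Sᵀ) *ᵥ a)
        + y ^ 2 * (Y ⬝ᵥ (R *ᵥ (M *ᵥ (Rᵀ *ᵥ Y))) - 4 * ((R *ᵥ B) ⬝ᵥ (Y - R *ᵥ B)))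
        + 2 * x * (a ⬝ᵥ ((S * R * M) *ᵥ e))
        + 2 * y * (2 * (a ⬝ᵥ (S *ᵥ Y)) - 2 * (a ⬝ᵥ (S *ᵥ (Y - R *ᵥ B)))
            - a ⬝ᵥ (S *ᵥ (R *ᵥ (M *ᵥ (Rᵀ *ᵥ Y)))))
        + 2 * x * y * (2 * (e ⬝ᵥ B) - e ⬝ᵥ (M *ᵥ (Rᵀ *ᵥ Y))) := by
  intro M c
  have hM : Mᵀ = M := by simp [M, transpose_nonsing_inv]
  have hMQ : ∀ v, Rᵀ *ᵥ (R *ᵥ (M *ᵥ v)) = v := fun v => by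
    rw [mulVec_mulVec, mulVec_mulVec, mul_nonsing_inv _ hR, one_mulVec]
  have hS : ∀ v, a ⬝ᵥ (S *ᵥ v) = (Sᵀ *ᵥ a) ⬝ᵥ v := fun v => by
    rw [dotProduct_mulVec, mulVec_transpose]
  have hRt : ∀ (v : m → ℝ) w, v ⬝ᵥ (R *ᵥ w) = (Rᵀ *ᵥ v) ⬝ᵥ w := fun v w => by
    rw [dotProduct_mulVec, mulVec_transpose]
  have hMc := dotProduct_mulVec_comm_of_transpose_eq hM
  have hQB : ∀ w, (Rᵀ *ᵥ (R *ᵥ B)) ⬝ᵥ (M *ᵥ w) = w ⬝ᵥ B := fun w => by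
    rw [← hRt, dotProduct_comm, hRt, hMQ]
  simp only [← mulVec_mulVec, hS, mulVec_sub, dotProduct_sub]
  rw [dotProduct_comm (R *ᵥ B) Y]
  simp only [hRt]
  simp only [c, mulVec_add, mulVec_smul, mulVec_sub, hMQ, add_dotProduct, dotProduct_add,
    sub_dotProduct, dotProduct_sub, smul_dotProduct, dotProduct_smul, smul_eq_mul, hQB]
  rw [hMc (Rᵀ *ᵥ (Sᵀ *ᵥ a)) e, hMc (Rᵀ *ᵥ Y) e, hMc (Rᵀ *ᵥ Y) (Rᵀ *ᵥ (Sᵀ *ᵥ a))]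
  ring

/-- Partialling out `a` from a nonnegative quadratic form in `(x, a, y)`, followed by the
Cauchy–Schwarz inequality for the resulting form in `(x, y)`. -/
theorem abs_le_sqrt_schur_of_quadratic_nonneg [DecidableEq ι] {V : Matrix ι ι ℝ} (hV : V.PosDef)
    (b u : ι → ℝ) (E m₀ k : ℝ)
    (h : ∀ (x y : ℝ) (a : ι → ℝ), 0 ≤ x ^ 2 * E + a ⬝ᵥ (V *ᵥ a) + y ^ 2 * m₀
      + 2 * x * (a ⬝ᵥ b) + 2 * y * (a ⬝ᵥ u) + 2 * x * y * k) :
    |k - b ⬝ᵥ (V⁻¹ *ᵥ u)|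
      ≤ Real.sqrt ((E - b ⬝ᵥ (V⁻¹ *ᵥ b)) * (m₀ - u ⬝ᵥ (V⁻¹ *ᵥ u))) := by
  have hVt : Vᵀ = V := by simpa using hV.isHermitian.eq
  have hdet : IsUnit V.det := (isUnit_iff_isUnit_det V).1 hV.isUnit
  have hVi : ∀ w, V *ᵥ (V⁻¹ *ᵥ w) = w := fun w => by
    rw [mulVec_mulVec, mul_nonsing_inv _ hdet, one_mulVec]
  have hcomm := dotProduct_mulVec_comm_of_transpose_eq
    (show (V⁻¹)ᵀ = V⁻¹ by rw [transpose_nonsing_inv, hVt])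
  have hd := discrim_le_zero (a := m₀ - u ⬝ᵥ (V⁻¹ *ᵥ u)) (b := 2 * (k - b ⬝ᵥ (V⁻¹ *ᵥ u)))
    (c := E - b ⬝ᵥ (V⁻¹ *ᵥ b)) fun y => by
      have := h 1 y (-(V⁻¹ *ᵥ (b + y • u)))
      simp only [mulVec_neg, hVi, neg_dotProduct, dotProduct_neg, mulVec_add, mulVec_smul,
        add_dotProduct, dotProduct_add, smul_dotProduct, dotProduct_smul, smul_eq_mul] at this
      simp only [dotProduct_comm (V⁻¹ *ᵥ _)] at this
      rw [hcomm u b] at this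
      linarith
  refine Real.abs_le_sqrt ?_
  rw [discrim] at hd
  linarith

end LinearAlgebra

/-- **Refined closed-form bounds for the mean of random coefficients (Proposition 2).**
Under Assumptions 1–3 and the instrument setup, `𝒱_S` is positive definite, and
`E(e'B)` lies in `[𝓑_S − √(𝓔_S 𝓓_S)/2, 𝓑_S + √(𝓔_S 𝓓_S)/2]`. -/
theorem mean_refined_bounds
    {T q p : ℕ} (hT : 1 ≤ T) (hqp : 1 ≤ q + p)
    {Ω : Type*} [MeasurableSpace Ω] (μ : Measure Ω) [IsProbabilityMeasure μ]
    (Z : Fin T → Ω → Fin q → ℝ) (X : Fin T → Ω → Fin p → ℝ)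
    (Y : Ω → Fin T → ℝ) (B : Ω → Fin (q + p) → ℝ)
    (hZ : ∀ t, Measurable (Z t)) (hX : ∀ t, Measurable (X t))
    (hY : Measurable Y) (hB : Measurable B)
    (R : Ω → Matrix (Fin T) (Fin (q + p)) ℝ)
    (hR : ∀ ω t, R ω t = Fin.append (Z t ω) (X t ω))
    -- Assumption 1 (sequential exogeneity)
    (hεint : ∀ t : Fin T, Integrable (fun ω => Y ω t - R ω t ⬝ᵥ B ω) μ)
    (hA1 : ∀ t : Fin T,
      μ[(fun ω => Y ω t - R ω t ⬝ᵥ B ω)|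
        MeasurableSpace.comap
          (fun ω => (B ω, fun u : Fin T => Z u ω, fun u : {u : Fin T // u ≤ t} => X u.1 ω))
          inferInstance] =ᵐ[μ] 0)
    -- Assumption 2 (no multicollinearity)
    (hA2 : ∀ᵐ ω ∂μ, ((R ω)ᵀ * R ω).PosDef)
    -- instrument setup
    (L : Fin T → ℕ) (St : (t : Fin T) → Ω → Fin (L t) → ℝ)
    (hSt : ∀ t, Measurable (St t))
    (S : Ω → Matrix ((t : Fin T) × Fin (L t)) (Fin T) ℝ)
    (hSdef : ∀ ω (pr : (t : Fin T) × Fin (L t)) (u : Fin T),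
      S ω pr u = if u = pr.1 then St pr.1 ω pr.2 else 0)
    (hSεint : ∀ (t : Fin T) (i : Fin (L t)),
      Integrable (fun ω => St t ω i * (Y ω t - R ω t ⬝ᵥ B ω)) μ)
    (hSε : ∀ (t : Fin T) (i : Fin (L t)),
      ∫ ω, St t ω i * (Y ω t - R ω t ⬝ᵥ B ω) ∂μ = 0)
    -- Assumption 3
    (hA3 : ∀ a : (t : Fin T) → Fin (L t) → ℝ, a ≠ 0 →
      0 < μ {ω | ∑ t, (St t ω ⬝ᵥ a t) • R ω t ≠ 0})
    (e : Fin (q + p) → ℝ)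
    -- all relevant expectations exist and are finite
    (hIeB : Integrable (fun ω => e ⬝ᵥ B ω) μ)
    (hI1 : ∀ i j, Integrable
      (fun ω => (S ω * R ω * ((R ω)ᵀ * R ω)⁻¹ * (R ω)ᵀ * (S ω)ᵀ) i j) μ)
    (hI2 : ∀ i, Integrable
      (fun ω => (S ω *ᵥ (R ω *ᵥ (((R ω)ᵀ * R ω)⁻¹ *ᵥ ((R ω)ᵀ *ᵥ Y ω)))) i) μ)
    (hI3 : ∀ i j, Integrable (fun ω => (S ω * R ω * ((R ω)ᵀ * R ω)⁻¹) i j) μ)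
    (hI4 : ∀ i, Integrable (fun ω => (S ω *ᵥ Y ω) i) μ)
    (hI5 : Integrable
      (fun ω => Y ω ⬝ᵥ (R ω *ᵥ (((R ω)ᵀ * R ω)⁻¹ *ᵥ ((R ω)ᵀ *ᵥ Y ω)))) μ)
    (hI6 : ∀ i, Integrable (fun ω => (((R ω)ᵀ * R ω)⁻¹ *ᵥ ((R ω)ᵀ *ᵥ Y ω)) i) μ)
    (hI7 : ∀ i j, Integrable (fun ω => (((R ω)ᵀ * R ω)⁻¹) i j) μ)
    (hIRBε : ∀ t : Fin T,
      Integrable (fun ω => (R ω t ⬝ᵥ B ω) * (Y ω t - R ω t ⬝ᵥ B ω)) μ) :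
    ∀ (VS : Matrix ((t : Fin T) × Fin (L t)) ((t : Fin T) × Fin (L t)) ℝ)
      (PS : Matrix ((t : Fin T) × Fin (L t)) (Fin (q + p)) ℝ)
      (YS Ys : ((t : Fin T) × Fin (L t)) → ℝ) (m0 BS ES DS : ℝ),
      VS = EMat μ (fun ω => S ω * R ω * ((R ω)ᵀ * R ω)⁻¹ * (R ω)ᵀ * (S ω)ᵀ) →
      PS = EMat μ (fun ω => S ω * R ω * ((R ω)ᵀ * R ω)⁻¹) →
      YS = EVec μ (fun ω => S ω *ᵥ (R ω *ᵥ (((R ω)ᵀ * R ω)⁻¹ *ᵥ ((R ω)ᵀ *ᵥ Y ω)))) →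
      Ys = EVec μ (fun ω => S ω *ᵥ Y ω) →
      m0 = ∫ ω, Y ω ⬝ᵥ (R ω *ᵥ (((R ω)ᵀ * R ω)⁻¹ *ᵥ ((R ω)ᵀ *ᵥ Y ω))) ∂μ →
      BS = (1 / 2) * (e ⬝ᵥ EVec μ (fun ω => ((R ω)ᵀ * R ω)⁻¹ *ᵥ ((R ω)ᵀ *ᵥ Y ω)))
          + (1 / 2) * (e ⬝ᵥ (PSᵀ *ᵥ (VS⁻¹ *ᵥ ((2 : ℝ) • Ys - YS)))) →
      ES = e ⬝ᵥ (EMat μ (fun ω => ((R ω)ᵀ * R ω)⁻¹) *ᵥ e)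
          - e ⬝ᵥ (PSᵀ *ᵥ (VS⁻¹ *ᵥ (PS *ᵥ e))) →
      DS = m0 - ((2 : ℝ) • Ys - YS) ⬝ᵥ (VS⁻¹ *ᵥ ((2 : ℝ) • Ys - YS)) →
      VS.PosDef ∧
      (BS - Real.sqrt (ES * DS) / 2 ≤ ∫ ω, e ⬝ᵥ B ω ∂μ ∧
        ∫ ω, e ⬝ᵥ B ω ∂μ ≤ BS + Real.sqrt (ES * DS) / 2) := by
  intro VS PS YS Ys m0 BS ES DS hVS hPS hYS hYs hm0 hBS hES hDS
  have hSa : ∀ ω (a : (t : Fin T) × Fin (L t) → ℝ),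
      (R ω)ᵀ *ᵥ ((S ω)ᵀ *ᵥ a) = ∑ t, (St t ω ⬝ᵥ fun i => a ⟨t, i⟩) • R ω t := by
    intro ω a
    ext j
    simp only [mulVec, dotProduct, transpose_apply, Finset.sum_apply, Pi.smul_apply, smul_eq_mul,
      hSdef, Fintype.sum_sigma, ite_mul, zero_mul]
    refine Finset.sum_congr rfl fun t _ => ?_
    rw [mul_comm, Finset.sum_eq_single t (fun u _ hu => by simp [hu.symm]) (by simp)]
    simp
  have hSv : ∀ ω (v : Fin T → ℝ) (i : (t : Fin T) × Fin (L t)),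
      (S ω *ᵥ v) i = St i.1 ω i.2 * v i.1 := by
    intro ω v i
    simp [mulVec, dotProduct, hSdef]
  have hSεI : ∀ i, Integrable (fun ω => (S ω *ᵥ (Y ω - R ω *ᵥ B ω)) i) μ := fun i => by
    simp only [hSv]
    exact hSεint i.1 i.2
  have hSεE : EVec μ (fun ω => S ω *ᵥ (Y ω - R ω *ᵥ B ω)) = 0 := by
    ext i
    simp only [EVec, hSv]
    exact hSε i.1 i.2
  have hRBI : Integrable (fun ω => (R ω *ᵥ B ω) ⬝ᵥ (Y ω - R ω *ᵥ B ω)) μ :=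
    integrable_finsetSum _ fun t _ => hIRBε t
  have hRBE : ∫ ω, (R ω *ᵥ B ω) ⬝ᵥ (Y ω - R ω *ᵥ B ω) ∂μ = 0 := by
    have hsum := integral_finsetSum (μ := μ) Finset.univ fun t _ => hIRBε t
    refine hsum.trans (Finset.sum_eq_zero fun t _ => ?_)
    have happ : Measurable fun x : (Fin (q + p) → ℝ) × (Fin T → Fin q → ℝ) ×
        ({u : Fin T // u ≤ t} → Fin p → ℝ) =>
        Fin.append (x.2.1 t) (x.2.2 ⟨t, le_rfl⟩) ⬝ᵥ x.1 := by
      refine Finset.measurable_sum _ fun i _ => Measurable.mul ?_ (by fun_prop)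
      refine Fin.addCases (fun j => ?_) (fun j => ?_) i
      · simp only [Fin.append_left]; fun_prop
      · simp only [Fin.append_right]; fun_prop
    have hmeas : Measurable (fun ω =>
        (B ω, fun u : Fin T => Z u ω, fun u : {u : Fin T // u ≤ t} => X u.1 ω)) :=
      hB.prodMk ((measurable_pi_lambda _ hZ).prodMk (measurable_pi_lambda _ fun u => hX u.1))
    refine integral_mul_eq_zero_of_condExp_eq_zero hmeas.comap_le ?_ (hIRBε t) (hεint t) (hA1 t)
    have hcomp := (happ.comp (comap_measurable (fun ω =>
        (B ω, fun u : Fin T => Z u ω, fun u : {u : Fin T // u ≤ t} => X u.1 ω)))).stronglyMeasurable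
    simpa only [Function.comp_def, ← hR] using hcomp
  have hquad : ∀ a, a ⬝ᵥ (VS *ᵥ a) =
      ∫ ω, a ⬝ᵥ ((S ω * R ω * ((R ω)ᵀ * R ω)⁻¹ * (R ω)ᵀ * (S ω)ᵀ) *ᵥ a) ∂μ := fun a => by
    rw [hVS, integral_dotProduct_mulVec_const a a hI1]
  have hVSpos : VS.PosDef := by
    refine PosDef.of_dotProduct_mulVec_pos ?_ fun a ha => ?_
    · ext i j
      rw [hVS, conjTranspose_apply, star_trivial, EMat, of_apply, of_apply]
      refine integral_congr_ae (.of_forall fun ω => ?_)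
      simp only
      rw [← transpose_apply (_ * _)]
      simp only [transpose_mul, transpose_nonsing_inv, transpose_transpose, Matrix.mul_assoc]
    rw [star_trivial, hquad]
    have hform : ∀ ω, a ⬝ᵥ ((S ω * R ω * ((R ω)ᵀ * R ω)⁻¹ * (R ω)ᵀ * (S ω)ᵀ) *ᵥ a) =
        ((R ω)ᵀ *ᵥ ((S ω)ᵀ *ᵥ a)) ⬝ᵥ (((R ω)ᵀ * R ω)⁻¹ *ᵥ ((R ω)ᵀ *ᵥ ((S ω)ᵀ *ᵥ a))) := by
      intro ω
      have := dotProduct_mul_mul_transpose_mulVec (S ω * R ω) ((R ω)ᵀ * R ω)⁻¹ a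
      simpa only [transpose_mul, ← mulVec_mulVec, ← Matrix.mul_assoc] using this
    rw [integral_pos_iff_support_of_nonneg_ae]
    · have ha' : (fun t i => a ⟨t, i⟩ : (t : Fin T) → Fin (L t) → ℝ) ≠ 0 := fun h0 =>
        ha (funext fun i => congrFun (congrFun h0 i.1) i.2)
      refine (hA3 _ ha').trans_le (measure_mono_ae ?_)
      filter_upwards [hA2] with ω hω hne
      have := hω.inv.dotProduct_mulVec_pos (x := (R ω)ᵀ *ᵥ ((S ω)ᵀ *ᵥ a))
        (by rw [hSa]; exact hne)
      rw [star_trivial, ← hform] at this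
      exact this.ne'
    · filter_upwards [hA2] with ω hω
      have := hω.inv.posSemidef.dotProduct_mulVec_nonneg ((R ω)ᵀ *ᵥ ((S ω)ᵀ *ᵥ a))
      rwa [star_trivial, ← hform] at this
    · exact integrable_dotProduct_mulVec_const a a hI1
  refine ⟨hVSpos, ?_⟩
  have hcs := abs_le_sqrt_schur_of_quadratic_nonneg hVSpos (PS *ᵥ e) ((2 : ℝ) • Ys - YS)
    (e ⬝ᵥ (EMat μ (fun ω => ((R ω)ᵀ * R ω)⁻¹) *ᵥ e)) m0
    (2 * ∫ ω, e ⬝ᵥ B ω ∂μ - e ⬝ᵥ EVec μ (fun ω => ((R ω)ᵀ * R ω)⁻¹ *ᵥ ((R ω)ᵀ *ᵥ Y ω))) ?_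
  · have hPSe : ∀ w, e ⬝ᵥ (PSᵀ *ᵥ w) = (PS *ᵥ e) ⬝ᵥ w := fun w => by
      rw [dotProduct_mulVec, vecMul_transpose]
    rw [← hPSe, ← hPSe, ← hES, ← hDS, abs_le] at hcs
    constructor <;> linarith [hcs.1, hcs.2]
  intro x y a
  have hnonneg := integral_nonneg_of_ae (μ := μ) (f := fun ω =>
    x ^ 2 * (e ⬝ᵥ (((R ω)ᵀ * R ω)⁻¹ *ᵥ e))
      + a ⬝ᵥ ((S ω * R ω * ((R ω)ᵀ * R ω)⁻¹ * (R ω)ᵀ * (S ω)ᵀ) *ᵥ a)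
      + y ^ 2 * (Y ω ⬝ᵥ (R ω *ᵥ (((R ω)ᵀ * R ω)⁻¹ *ᵥ ((R ω)ᵀ *ᵥ Y ω)))
          - 4 * ((R ω *ᵥ B ω) ⬝ᵥ (Y ω - R ω *ᵥ B ω)))
      + 2 * x * (a ⬝ᵥ ((S ω * R ω * ((R ω)ᵀ * R ω)⁻¹) *ᵥ e))
      + 2 * y * (2 * (a ⬝ᵥ (S ω *ᵥ Y ω)) - 2 * (a ⬝ᵥ (S ω *ᵥ (Y ω - R ω *ᵥ B ω)))
          - a ⬝ᵥ (S ω *ᵥ (R ω *ᵥ (((R ω)ᵀ * R ω)⁻¹ *ᵥ ((R ω)ᵀ *ᵥ Y ω)))))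
      + 2 * x * y * (2 * (e ⬝ᵥ B ω) - e ⬝ᵥ (((R ω)ᵀ * R ω)⁻¹ *ᵥ ((R ω)ᵀ *ᵥ Y ω)))) (by
    filter_upwards [hA2] with ω hω
    have hexp := dotProduct_self_projection_expansion (S ω) (R ω)
      ((isUnit_iff_isUnit_det _).1 hω.isUnit) (Y ω) (B ω) e a x y
    exact (Finset.sum_nonneg fun i _ => mul_self_nonneg _).trans_eq hexp)
  rw [integral_quadratic_combination (integrable_dotProduct_mulVec_const e e hI7)
    (integrable_dotProduct_mulVec_const a a hI1) hI5 hRBI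
    (integrable_dotProduct_mulVec_const a e hI3) (integrable_dotProduct_const a hI4)
    (integrable_dotProduct_const a hSεI) (integrable_dotProduct_const a hI2) hIeB
    (integrable_dotProduct_const e hI6), integral_dotProduct_mulVec_const e e hI7, ← hquad,
    ← hm0, hRBE, integral_dotProduct_mulVec_const a e hI3, ← hPS,
    integral_dotProduct_const a hI4, ← hYs, integral_dotProduct_const a hSεI, hSεE,
    integral_dotProduct_const a hI2, ← hYS, integral_dotProduct_const e hI6,
    dotProduct_zero] at hnonneg
  rw [dotProduct_sub, dotProduct_smul, smul_eq_mul]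
  linarith
end
end
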